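/- arXiv:1907.10657 — 2 statements merged into one kernel-verified Lean document; each statement's English description precedes it below -/
import Mathlib

section
/- Let n ≥ 2, A(s) = sI_n + A with A ∈ F^{n×n}, and let P ∈ F^{n×n} be a constant matrix with rank(P) = r₁. For any integer r with r₁ < r < n, there exists a matrix pencil P(s) ∈ F[s]^{n×n} with normal rank exactly r such that A(s) + P(s) is strictly equivalent to A(s) + P. -/
/-- A polynomial matrix is a (matrix) pencil if every entry has degree at most 1. -/
def IsPencil {F : Type*} [Field F] {m n : ℕ} (M : Matrix (Fin m) (Fin n) (Polynomial F)) : Prop :=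
  ∀ i j, (M i j).degree ≤ 1

/-- Normal rank of a polynomial matrix: its rank over the field of rational functions. -/
noncomputable def normalRank {F : Type*} [Field F] {m n : ℕ}
    (M : Matrix (Fin m) (Fin n) (Polynomial F)) : ℕ :=
  (M.map (algebraMap (Polynomial F) (RatFunc F))).rank

/-- Strict equivalence of polynomial matrices (pencils):
`G = Q * H * R` for invertible constant matrices `Q`, `R`. -/
def StrictEquiv {F : Type*} [Field F] {m n : ℕ}
    (G H : Matrix (Fin m) (Fin n) (Polynomial F)) : Prop :=
  ∃ (Q : Matrix (Fin m) (Fin m) F) (R : Matrix (Fin n) (Fin n) F),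
    IsUnit Q.det ∧ IsUnit R.det ∧ G = (Q.map Polynomial.C) * H * (R.map Polynomial.C)

/-- The pencil `G₀ + s G₁` as a polynomial matrix. -/
noncomputable def pencilOf {F : Type*} [Field F] {m n : ℕ}
    (G₀ G₁ : Matrix (Fin m) (Fin n) F) : Matrix (Fin m) (Fin n) (Polynomial F) :=
  G₀.map Polynomial.C + (Polynomial.X : Polynomial F) • G₁.map Polynomial.C

/-- The homogeneous pencil `t G₀ + s G₁` (variables `s = X 0`, `t = X 1`). -/
noncomputable def homPencil {F : Type*} [Field F] {m n : ℕ}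
    (G₀ G₁ : Matrix (Fin m) (Fin n) F) : Matrix (Fin m) (Fin n) (MvPolynomial (Fin 2) F) :=
  (MvPolynomial.X 1 : MvPolynomial (Fin 2) F) • G₀.map MvPolynomial.C +
    (MvPolynomial.X 0 : MvPolynomial (Fin 2) F) • G₁.map MvPolynomial.C

/-- The set of `k × k` minors of a matrix. -/
def minorsSet {R : Type*} [CommRing R] {m n : ℕ} (M : Matrix (Fin m) (Fin n) R) (k : ℕ) :
    Set R :=
  { d | ∃ (ri : Fin k → Fin m) (ci : Fin k → Fin n),
      Function.Injective ri ∧ Function.Injective ci ∧ d = (M.submatrix ri ci).det }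

/-- `g` is a greatest common divisor of the set `S`. -/
def IsGCDOf {R : Type*} [CommRing R] (g : R) (S : Set R) : Prop :=
  (∀ x ∈ S, g ∣ x) ∧ ∀ d : R, (∀ x ∈ S, d ∣ x) → d ∣ g

/-- `φ 0, …, φ (n-1)` are homogeneous invariant factors (up to units) of the pencil
`G₀ + s G₁`: for each `k ≤ n` the product of the first `k` of them is a gcd of the
`k × k` minors of the homogeneous pencil `t G₀ + s G₁`. -/
def IsHomogeneousIF {F : Type*} [Field F] {n : ℕ} (G₀ G₁ : Matrix (Fin n) (Fin n) F)
    (φ : ℕ → MvPolynomial (Fin 2) F) : Prop :=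
  ∀ k : ℕ, k ≤ n → IsGCDOf (∏ i ∈ Finset.range k, φ i) (minorsSet (homPencil G₀ G₁) k)

/-- Extension of a finite family of invariant factors (indexed `1, …, n`, stored with
offset `1` so that `φ 0` is the first one) to all integer indices, with the convention
that it is `1` below the range and `0` above it. -/
def extIF {R : Type*} [CommRing R] (n : ℕ) (φ : ℕ → R) : ℤ → R :=
  fun j => if j < 1 then 1 else if (n : ℤ) < j then 0 else φ (j - 1).toNat

/-- Interlacing condition `φ_{i-r} ∣ ψ_i ∣ φ_{i+r}`, `1 ≤ i ≤ n`. -/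
def Interlace {R : Type*} [CommRing R] (n r : ℕ) (φ ψ : ℕ → R) : Prop :=
  ∀ i : ℕ, 1 ≤ i → i ≤ n →
    extIF n φ ((i : ℤ) - r) ∣ extIF n ψ (i : ℤ) ∧
      extIF n ψ (i : ℤ) ∣ extIF n φ ((i : ℤ) + r)

/-- The operation `P_X` on pencils, acting on the pair `(G₀, G₁)` of coefficients of
`G(s) = G₀ + s G₁`: for `X = [[x, y], [z, w]]`,
`P_X(s G₁ + G₀) = s (x G₁ + z G₀) + (y G₁ + w G₀)`. -/
def mapP {F : Type*} [Field F] {m n : ℕ} (X : Matrix (Fin 2) (Fin 2) F)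
    (G : Matrix (Fin m) (Fin n) F × Matrix (Fin m) (Fin n) F) :
    Matrix (Fin m) (Fin n) F × Matrix (Fin m) (Fin n) F :=
  (X 0 1 • G.2 + X 1 1 • G.1, X 0 0 • G.2 + X 1 0 • G.1)

/-- The substitution `Π_X(Φ)(s, t) = Φ(s x + t y, s z + t w)` for `X = [[x, y], [z, w]]`. -/
noncomputable def PiX {F : Type*} [Field F] (X : Matrix (Fin 2) (Fin 2) F)
    (Φ : MvPolynomial (Fin 2) F) : MvPolynomial (Fin 2) F :=
  MvPolynomial.aeval
    ![MvPolynomial.C (X 0 0) * MvPolynomial.X 0 + MvPolynomial.C (X 0 1) * MvPolynomial.X 1,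
      MvPolynomial.C (X 1 0) * MvPolynomial.X 0 + MvPolynomial.C (X 1 1) * MvPolynomial.X 1] Φ

/-- The homogeneous invariant factor of a nonzero `1 × 1` pencil `a(s) = a₀ + s a₁`:
the homogenization `t a₀ + s a₁`, made monic with respect to `s`
(equal to `t` when `a₁ = 0`). -/
noncomputable def homIF1 {F : Type*} [Field F] (a : Polynomial F) : MvPolynomial (Fin 2) F :=
  MvPolynomial.C (a.leadingCoeff)⁻¹ *
    (MvPolynomial.C (a.coeff 1) * MvPolynomial.X 0 + MvPolynomial.C (a.coeff 0) * MvPolynomial.X 1)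

/-- The homogeneous pencil associated to a polynomial matrix pencil. -/
noncomputable def homOf {F : Type*} [Field F] {n : ℕ}
    (M : Matrix (Fin n) (Fin n) (Polynomial F)) : Matrix (Fin n) (Fin n) (MvPolynomial (Fin 2) F) :=
  homPencil (M.map fun p => p.coeff 0) (M.map fun p => p.coeff 1)

open Polynomial in
theorem map_C_mul_pencilOf_mul_map_C {F : Type*} [Field F] {m n : ℕ}
    (Q : Matrix (Fin m) (Fin m) F) (G₀ G₁ : Matrix (Fin m) (Fin n) F)
    (R : Matrix (Fin n) (Fin n) F) :
    Q.map C * pencilOf G₀ G₁ * R.map C = pencilOf (Q * G₀ * R) (Q * G₁ * R) := by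
  simp [pencilOf, Matrix.mul_add, Matrix.add_mul, Matrix.map_mul]

open Polynomial in
theorem pencilOf_add {F : Type*} [Field F] {m n : ℕ} (G₀ G₁ H₀ H₁ : Matrix (Fin m) (Fin n) F) :
    pencilOf G₀ G₁ + pencilOf H₀ H₁ = pencilOf (G₀ + H₀) (G₁ + H₁) := by
  simp only [pencilOf, Matrix.map_add _ C.map_add, smul_add]
  abel

open Polynomial in
theorem map_C_eq_pencilOf {F : Type*} [Field F] {m n : ℕ} (G : Matrix (Fin m) (Fin n) F) :
    G.map C = pencilOf G 0 := by
  simp [pencilOf]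

open Polynomial in
theorem isPencil_pencilOf {F : Type*} [Field F] {m n : ℕ} (G₀ G₁ : Matrix (Fin m) (Fin n) F) :
    IsPencil (pencilOf G₀ G₁) := by
  intro i j
  have h : pencilOf G₀ G₁ i j = C (G₁ i j) * X + C (G₀ i j) := by
    simp only [pencilOf, Matrix.add_apply, Matrix.smul_apply, Matrix.map_apply, smul_eq_mul]
    ring
  rw [h]
  exact degree_linear_le

open Polynomial in
theorem normalRank_map_C_mul_mul_map_C {F : Type*} [Field F] {m n : ℕ}
    {Q : Matrix (Fin m) (Fin m) F} {R : Matrix (Fin n) (Fin n) F}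
    (hQ : IsUnit Q.det) (hR : IsUnit R.det) (M : Matrix (Fin m) (Fin n) F[X]) :
    normalRank (Q.map C * M * R.map C) = normalRank M := by
  have key {k : ℕ} {S : Matrix (Fin k) (Fin k) F} (hS : IsUnit S.det) :
      IsUnit ((S.map C).map (algebraMap F[X] (RatFunc F))).det := by
    have h := (hS.map (C : F →+* F[X])).map (algebraMap F[X] (RatFunc F))
    rwa [RingHom.map_det, RingHom.map_det] at h
  rw [normalRank, Matrix.map_mul, Matrix.map_mul,
    Matrix.rank_mul_eq_left_of_isUnit_det _ _ (key hR),
    Matrix.rank_mul_eq_right_of_isUnit_det _ _ (key hQ), normalRank]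

theorem Matrix.rank_le_of_row_eq_zero {K : Type*} [Field K] {m n r : ℕ}
    (M : Matrix (Fin m) (Fin n) K) (hr : r ≤ m) (h : ∀ i : Fin m, r ≤ i → ∀ j, M i j = 0) :
    M.rank ≤ r := by
  have hM : M = (1 : Matrix (Fin m) (Fin m) K).submatrix id (Fin.castLE hr) *
      M.submatrix (Fin.castLE hr) id := by
    ext i j
    rw [Matrix.mul_apply]
    by_cases hi : r ≤ i
    · rw [h i hi j, Finset.sum_eq_zero]
      intro k _
      have : i ≠ Fin.castLE hr k := by
        rintro rfl
        simp only [Fin.val_castLE] at hi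
        omega
      simp [this]
    · rw [Finset.sum_eq_single ⟨i, by omega⟩]
      · have : i = Fin.castLE hr ⟨i, by omega⟩ := rfl
        simp [Matrix.one_apply, ← this]
      · intro k _ hk
        have : i ≠ Fin.castLE hr k := by
          rintro rfl
          exact hk rfl
        simp [this]
      · simp
  rw [hM]
  exact (Matrix.rank_mul_le_left _ _).trans (Matrix.rank_le_width _)

theorem Matrix.le_rank_of_det_submatrix_ne_zero {K : Type*} [Field K] {m n r : ℕ}
    (M : Matrix (Fin m) (Fin n) K) (f : Fin r → Fin m) (g : Fin r → Fin n)
    (h : (M.submatrix f g).det ≠ 0) : r ≤ M.rank := by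
  have hM : M.submatrix f g = (1 : Matrix (Fin m) (Fin m) K).submatrix f id * M *
      (1 : Matrix (Fin n) (Fin n) K).submatrix id g := by
    ext i j
    simp [Matrix.mul_apply, Matrix.one_apply]
  calc r = (M.submatrix f g).rank := by
        rw [Matrix.rank_of_isUnit _ ((Matrix.isUnit_iff_isUnit_det _).2 h.isUnit),
          Fintype.card_fin]
    _ ≤ M.rank := by
        rw [hM]
        exact (Matrix.rank_mul_le_left _ _).trans (Matrix.rank_mul_le_right _ _)

/-- The nilpotent matrix of rank `r` (for `r < n`) with ones in the first `r` places of the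
superdiagonal. -/
def truncatedShift (F : Type*) [Field F] (n r : ℕ) : Matrix (Fin n) (Fin n) F :=
  Matrix.of fun i j => if (i : ℕ) < r ∧ (j : ℕ) = i + 1 then 1 else 0

theorem det_one_add_truncatedShift (F : Type*) [Field F] (n r : ℕ) :
    (1 + truncatedShift F n r).det = 1 := by
  rw [Matrix.det_of_isUpperTriangular]
  · simp [truncatedShift]
  · intro i j hij
    have hij : j < i := hij
    have h : ¬ ((j : ℕ) = i + 1) := by omega
    simp [truncatedShift, hij.ne', h]

open Polynomial in
theorem normalRank_pencilOf_truncatedShift {F : Type*} [Field F] {n r : ℕ} (hr : r < n)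
    (G : Matrix (Fin n) (Fin n) F) (hG : ∀ i : Fin n, r ≤ i → ∀ j, G i j = 0) :
    normalRank (pencilOf G (truncatedShift F n r)) = r := by
  apply le_antisymm
  · apply Matrix.rank_le_of_row_eq_zero _ hr.le
    intro i hi j
    simp [pencilOf, truncatedShift, hG i hi j, hi.not_gt]
  · let f : Fin r → Fin n := Fin.castLE hr.le
    let g : Fin r → Fin n := fun j => Fin.castLE hr j.succ
    apply Matrix.le_rank_of_det_submatrix_ne_zero _ f g
    have h : (pencilOf G (truncatedShift F n r)).submatrix f g =
        (-G.submatrix f g).charmatrix := by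
      ext1 i j
      by_cases hij : i = j
      · subst hij
        simp [pencilOf, truncatedShift, f, g, add_comm]
      · have : ¬ ((j : ℕ) = i) := fun h => hij (Fin.ext h.symm)
        simp [pencilOf, truncatedShift, f, g, hij, this]
    have hdet := RingHom.map_det (algebraMap F[X] (RatFunc F))
      ((pencilOf G (truncatedShift F n r)).submatrix f g)
    rw [RingHom.mapMatrix_apply, ← Matrix.submatrix_map] at hdet
    rw [← hdet, h]
    exact (map_ne_zero_iff _ (IsFractionRing.injective F[X] (RatFunc F))).2
      (-G.submatrix f g).charpoly_monic.ne_zero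

open Matrix in
theorem Matrix.exists_isUnit_det_mul_row_eq_zero {F : Type*} [Field F] {m n : ℕ}
    (P : Matrix (Fin m) (Fin n) F) :
    ∃ T : Matrix (Fin m) (Fin m) F, IsUnit T.det ∧
      ∀ i : Fin m, P.rank ≤ i → ∀ j, (T * P) i j = 0 := by
  let W := LinearMap.range P.mulVecLin
  obtain ⟨W', hW⟩ := W.exists_isCompl
  have hW_rank : Module.finrank F W = P.rank := rfl
  have hcard : Module.finrank F W + Module.finrank F W' = m := by
    simpa using Submodule.finrank_add_eq_of_isCompl hW
  let b := (((Module.finBasis F W).prod (Module.finBasis F W')).map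
    (Submodule.prodEquivOfIsCompl W W' hW)).reindex (finSumFinEquiv.trans (finCongr hcard))
  refine ⟨LinearMap.toMatrix' b.equivFun.toLinearMap, ?_, fun i hi j => ?_⟩
  · rw [LinearMap.det_toMatrix']
    exact b.equivFun.isUnit_det'
  · have hcol : (LinearMap.toMatrix' b.equivFun.toLinearMap * P).col j =
        b.equivFun (P.col j) := by
      change LinearMap.toMatrix' b.equivFun.toLinearMap *ᵥ P.col j = _
      rw [LinearMap.toMatrix'_mulVec]
      rfl
    have hmem : P.col j ∈ W := ⟨Pi.single j 1, by simp⟩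
    change (LinearMap.toMatrix' b.equivFun.toLinearMap * P).col j i = 0
    rw [hcol]
    obtain ⟨k, rfl⟩ := (finSumFinEquiv.trans (finCongr hcard)).surjective i
    rcases k with k | k
    · have := k.isLt
      simp at hi
      omega
    · rw [Module.Basis.equivFun_apply, Module.Basis.repr_reindex_apply, Equiv.symm_apply_apply]
      simp [Submodule.prodEquivOfIsCompl_symm_apply_left _ _ hW ⟨_, hmem⟩]

/-- For `n ≥ 2`, `A(s) = sI + A`, a constant matrix `P` of rank `r₁` and
`r₁ < r < n`, there is a pencil `P(s)` of normal rank exactly `r` with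
`A(s) + P(s)` strictly equivalent to `A(s) + P`. -/
theorem stmt4 (F : Type*) [Field F] (n : ℕ) (hn : 2 ≤ n)
    (A P : Matrix (Fin n) (Fin n) F) (r₁ r : ℕ) (hP : P.rank = r₁)
    (h1 : r₁ < r) (h2 : r < n) :
    ∃ Ps : Matrix (Fin n) (Fin n) (Polynomial F), IsPencil Ps ∧ normalRank Ps = r ∧
      StrictEquiv (pencilOf A 1 + Ps) (pencilOf A 1 + P.map Polynomial.C) := by
  obtain ⟨T, hT, hTP⟩ := P.exists_isUnit_det_mul_row_eq_zero
  have hT' : IsUnit T⁻¹.det := T.isUnit_nonsing_inv_det hT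
  set J := truncatedShift F n r with hJ
  refine ⟨pencilOf (T⁻¹ * J * T * (A + P) + P) (T⁻¹ * J * T), isPencil_pencilOf _ _, ?_,
    T⁻¹ * (1 + J) * T, 1, ?_, by simp, ?_⟩
  · rw [← normalRank_map_C_mul_mul_map_C hT hT', map_C_mul_pencilOf_mul_map_C]
    have hlead : T * (T⁻¹ * J * T) * T⁻¹ = J := by
      simp [← Matrix.mul_assoc, Matrix.mul_nonsing_inv _ hT,
        Matrix.mul_nonsing_inv_cancel_right _ _ hT]
    have hconst : T * (T⁻¹ * J * T * (A + P) + P) * T⁻¹ =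
        J * (T * (A + P) * T⁻¹) + T * P * T⁻¹ := by
      simp [Matrix.mul_add, Matrix.add_mul, ← Matrix.mul_assoc, Matrix.mul_nonsing_inv _ hT]
    rw [hlead, hconst]
    apply normalRank_pencilOf_truncatedShift h2
    intro i hi j
    have hJi (k : Fin n) : J i k = 0 := by simp [hJ, truncatedShift, hi.not_gt]
    have hTPi (k : Fin n) : (T * P) i k = 0 := hTP i (by omega) k
    simp [Matrix.mul_apply (M := J), Matrix.mul_apply (M := T * P), hJi, hTPi]
  · rw [Matrix.det_mul, Matrix.det_mul, det_one_add_truncatedShift, mul_one]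
    exact hT'.mul hT
  · rw [map_C_eq_pencilOf P, pencilOf_add, pencilOf_add, map_C_mul_pencilOf_mul_map_C]
    congr 1
    · simp [Matrix.mul_add, Matrix.add_mul, Matrix.nonsing_inv_mul _ hT]
      abel
    · simp [Matrix.mul_add, Matrix.add_mul, Matrix.nonsing_inv_mul _ hT]
end

section
/- Let n ≥ 2 and A(s) = sI_n + A, B(s) = sI_n + B pencils over F with homogeneous invariant factors φ₁(s,t) | ⋯ | φ_n(s,t) and ψ₁(s,t) | ⋯ | ψ_n(s,t), respectively. Let 0 ≤ r ≤ n. If φ_{i−r}(s,t) | ψ_i(s,t) | φ_{i+r}(s,t) for all 1 ≤ i ≤ n (with the conventions φ_j = 1 for j < 1 and φ_j = 0 for j > n), then there exists a pencil P(s) ∈ F[s]^{n×n} with normal rank exactly r such that A(s) + P(s) is strictly equivalent to B(s). -/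
/-- Two square matrices are unit equivalent if they differ by invertible left and right factors. -/
def UnitEquiv {ι R : Type*} [Fintype ι] [DecidableEq ι] [CommRing R] (M N : Matrix ι ι R) : Prop :=
  ∃ P Q : (Matrix ι ι R)ˣ, (P : Matrix ι ι R) * M * Q = N

namespace UnitEquiv

variable {ι κ R : Type*} [Fintype ι] [DecidableEq ι] [Fintype κ] [DecidableEq κ] [CommRing R]
  {M N L : Matrix ι ι R}

lemma refl (M : Matrix ι ι R) : UnitEquiv M M := ⟨1, 1, by simp⟩

lemma trans (h₁ : UnitEquiv M N) (h₂ : UnitEquiv N L) : UnitEquiv M L := by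
  obtain ⟨P, Q, rfl⟩ := h₁
  obtain ⟨P', Q', rfl⟩ := h₂
  exact ⟨P' * P, Q * Q', by simp [Matrix.mul_assoc]⟩

lemma symm (h : UnitEquiv M N) : UnitEquiv N M := by
  obtain ⟨P, Q, rfl⟩ := h
  exact ⟨P⁻¹, Q⁻¹, by simp [Matrix.mul_assoc]⟩

lemma of_isUnit {P Q : Matrix ι ι R} (hP : IsUnit P) (hQ : IsUnit Q) (h : P * M * Q = N) :
    UnitEquiv M N := by
  obtain ⟨P, rfl⟩ := hP
  obtain ⟨Q, rfl⟩ := hQ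
  exact ⟨P, Q, h⟩

lemma transpose (h : UnitEquiv M N) : UnitEquiv M.transpose N.transpose := by
  obtain ⟨P, Q, rfl⟩ := h
  refine of_isUnit (P := (Q : Matrix ι ι R).transpose) (Q := (P : Matrix ι ι R).transpose) ?_ ?_ ?_
  · rw [Matrix.isUnit_transpose]; exact Q.isUnit
  · rw [Matrix.isUnit_transpose]; exact P.isUnit
  · simp [Matrix.mul_assoc]

lemma transvection_mul (M : Matrix ι ι R) {i j : ι} (hij : i ≠ j) (c : R) :
    UnitEquiv M (Matrix.transvection i j c * M) := by
  refine of_isUnit (P := Matrix.transvection i j c) (Q := 1) ?_ isUnit_one (by simp)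
  rw [Matrix.isUnit_iff_isUnit_det, Matrix.det_transvection_of_ne _ _ hij]
  exact isUnit_one

lemma submatrix_perm (M : Matrix ι ι R) (σ τ : Equiv.Perm ι) :
    UnitEquiv M (M.submatrix σ τ) := by
  refine of_isUnit (P := (1 : Matrix ι ι R).submatrix σ id)
    (Q := (1 : Matrix ι ι R).submatrix id τ) ?_ ?_ ?_
  · rw [Matrix.isUnit_iff_isUnit_det, Matrix.det_permute, Matrix.det_one, mul_one]
    exact (Equiv.Perm.sign σ).isUnit.map (Int.castRingHom R)
  · rw [Matrix.isUnit_iff_isUnit_det, Matrix.det_permute', Matrix.det_one, mul_one]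
    exact (Equiv.Perm.sign τ).isUnit.map (Int.castRingHom R)
  · ext i j
    simp [Matrix.mul_apply, Matrix.one_apply]

lemma reindex (h : UnitEquiv M N) (e : κ ≃ ι) :
    UnitEquiv (M.submatrix e e) (N.submatrix e e) := by
  obtain ⟨P, Q, rfl⟩ := h
  refine of_isUnit (P := (P : Matrix ι ι R).submatrix e e)
    (Q := (Q : Matrix ι ι R).submatrix e e) ?_ ?_ ?_
  · rw [Matrix.isUnit_submatrix_equiv]; exact P.isUnit
  · rw [Matrix.isUnit_submatrix_equiv]; exact Q.isUnit
  · simp [Matrix.submatrix_mul_equiv]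

lemma dvd_apply (h : UnitEquiv M N) {a : R} (ha : ∀ i j, a ∣ M i j) (i j : ι) : a ∣ N i j := by
  obtain ⟨P, Q, rfl⟩ := h
  simp only [Matrix.mul_apply]
  exact Finset.dvd_sum fun k _ => Dvd.dvd.mul_right
    (Finset.dvd_sum fun l _ => Dvd.dvd.mul_left (ha _ _) _) _

end UnitEquiv

lemma exists_unitEquiv_dvd_apply {ι R : Type*} [Fintype ι] [DecidableEq ι] [EuclideanDomain R]
    (a : R) : ∀ (M : Matrix ι ι R) (i j : ι), M i j = a → a ≠ 0 →
      ∃ (N : Matrix ι ι R) (i j : ι), UnitEquiv M N ∧ N i j ≠ 0 ∧ ∀ k l, N i j ∣ N k l := by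
  refine EuclideanDomain.r_wellFounded.induction
    (C := fun a => ∀ (M : Matrix ι ι R) (i j : ι), M i j = a → a ≠ 0 →
      ∃ (N : Matrix ι ι R) (i j : ι), UnitEquiv M N ∧ N i j ≠ 0 ∧ ∀ k l, N i j ∣ N k l) a ?_
  intro a ih M i j hM ha
  have col : ∀ (M : Matrix ι ι R) (i j k : ι), M i j = a → ¬ a ∣ M k j →
      ∃ (N : Matrix ι ι R) (i j : ι), UnitEquiv M N ∧ N i j ≠ 0 ∧ ∀ k l, N i j ∣ N k l := by
    intro M i j k hM hk
    have hki : k ≠ i := by rintro rfl; exact hk (hM ▸ dvd_rfl)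
    have hrem : (Matrix.transvection k i (-(M k j / a)) * M) k j = M k j % a := by
      rw [Matrix.transvection_mul_apply_same, hM, EuclideanDomain.mod_eq_sub_mul_div]
      ring
    obtain ⟨N, i', j', hN, h⟩ := ih (M k j % a) (EuclideanDomain.mod_lt _ ha) _ k j hrem
      (fun h => hk (EuclideanDomain.mod_eq_zero.1 h))
    exact ⟨N, i', j', (UnitEquiv.transvection_mul M hki _).trans hN, h⟩
  have row : ∀ (M : Matrix ι ι R) (i j l : ι), M i j = a → ¬ a ∣ M i l →
      ∃ (N : Matrix ι ι R) (i j : ι), UnitEquiv M N ∧ N i j ≠ 0 ∧ ∀ k l, N i j ∣ N k l := by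
    intro M i j l hM hl
    obtain ⟨N, i', j', hN, h0, h⟩ := col M.transpose j i l hM hl
    exact ⟨N.transpose, j', i', by simpa using hN.transpose, h0, fun k l => h l k⟩
  by_cases hc : ∃ k, ¬ a ∣ M k j
  · obtain ⟨k, hk⟩ := hc
    exact col M i j k hM hk
  by_cases hr : ∃ l, ¬ a ∣ M i l
  · obtain ⟨l, hl⟩ := hr
    exact row M i j l hM hl
  by_cases hall : ∃ k l, ¬ a ∣ M k l
  · push Not at hc hr
    obtain ⟨k, l, hkl⟩ := hall
    have hki : k ≠ i := by rintro rfl; exact hkl (hr l)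
    set M' := Matrix.transvection k i (-(M k j / a)) * M with hM'
    have h1 : M' k j = 0 := by
      rw [hM', Matrix.transvection_mul_apply_same, hM]
      have := EuclideanDomain.mul_div_cancel' ha (hc k)
      rw [neg_mul, mul_comm, this, add_neg_cancel]
    have h2 : ∀ l, M' i l = M i l := fun l => by
      rw [hM', Matrix.transvection_mul_apply_of_ne _ _ _ _ hki.symm]
    have h3 : ¬ a ∣ M' k l := by
      rw [hM', Matrix.transvection_mul_apply_same]
      rwa [dvd_add_left (Dvd.dvd.mul_left (hr l) _)]
    obtain ⟨N, i', j', hN, h⟩ := row (Matrix.transvection i k 1 * M') i j l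
      (by rw [Matrix.transvection_mul_apply_same, h1, h2, hM]; ring)
      (by rw [Matrix.transvection_mul_apply_same, h2, one_mul]; rwa [dvd_add_right (hr l)])
    exact ⟨N, i', j', ((UnitEquiv.transvection_mul M hki _).trans
      (UnitEquiv.transvection_mul _ hki.symm _)).trans hN, h⟩
  · push Not at hall
    exact ⟨M, i, j, .refl M, hM ▸ ha, fun k l => hM ▸ hall k l⟩

lemma UnitEquiv.fromBlocks_of_dvd {κ R : Type*} [Fintype κ] [DecidableEq κ] [CommRing R]
    (M : Matrix (Unit ⊕ κ) (Unit ⊕ κ) R) (h : ∀ k l, M (.inl ()) (.inl ()) ∣ M k l) :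
    ∃ D : Matrix κ κ R,
      UnitEquiv M (Matrix.fromBlocks (.of fun _ _ => M (.inl ()) (.inl ())) 0 0 D) := by
  choose c hc using fun k : κ => h (.inr k) (.inl ())
  choose b hb using fun k : κ => h (.inl ()) (.inr k)
  set a := M (.inl ()) (.inl ()) with ha
  let cM : Matrix κ Unit R := .of fun k _ => c k
  let bM : Matrix Unit κ R := .of fun _ k => b k
  have hMb : M = Matrix.fromBlocks (.of fun _ _ => a) (.of fun _ k => a * b k)
      (.of fun k _ => a * c k)
      M.toBlocks₂₂ := by
    ext (i | i) (j | j) <;> simp [ha, Matrix.toBlocks₂₂, hc, hb]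
  refine ⟨M.toBlocks₂₂ - .of fun k l => a * c k * b l, ?_⟩
  refine .of_isUnit (P := Matrix.fromBlocks 1 0 (-cM) 1) (Q := Matrix.fromBlocks 1 (-bM) 0 1)
    ?_ ?_ ?_
  · simp [Matrix.isUnit_iff_isUnit_det]
  · simp [Matrix.isUnit_iff_isUnit_det]
  · rw [hMb]
    simp only [Matrix.fromBlocks_multiply]
    ext (i | i) (j | j) <;> simp [Matrix.mul_apply, cM, bM] <;> ring

lemma UnitEquiv.fromBlocks {κ R : Type*} [Fintype κ] [DecidableEq κ] [CommRing R]
    (A : Matrix Unit Unit R) {D D' : Matrix κ κ R} (h : UnitEquiv D D') :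
    UnitEquiv (Matrix.fromBlocks A 0 0 D) (Matrix.fromBlocks A 0 0 D') := by
  obtain ⟨P, Q, rfl⟩ := h
  refine .of_isUnit (P := Matrix.fromBlocks 1 0 0 P) (Q := Matrix.fromBlocks 1 0 0 Q)
    ?_ ?_ ?_
  · simp [Matrix.isUnit_iff_isUnit_det]
  · simp [Matrix.isUnit_iff_isUnit_det]
  · simp [Matrix.fromBlocks_multiply]

/-- Smith normal form over a Euclidean domain. -/
theorem exists_unitEquiv_diagonal {R : Type*} [EuclideanDomain R] :
    ∀ (n : ℕ) (M : Matrix (Fin n) (Fin n) R),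
      ∃ d : Fin n → R, (∀ i j, i ≤ j → d i ∣ d j) ∧ UnitEquiv M (Matrix.diagonal d) := by
  intro n
  induction n with
  | zero => exact fun M => ⟨0, fun i => i.elim0, by convert UnitEquiv.refl M; ext i; exact i.elim0⟩
  | succ n ih =>
    intro M
    by_cases hM : M = 0
    · exact ⟨0, fun _ _ _ => dvd_rfl, by rw [hM, Matrix.diagonal_zero']; exact .refl _⟩
    obtain ⟨i, j, hij⟩ : ∃ i j, M i j ≠ 0 := by
      by_contra! h
      exact hM (by ext i j; exact h i j)
    obtain ⟨N, i', j', hMN, -, hN⟩ := exists_unitEquiv_dvd_apply (M i j) M i j rfl hij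
    let e : Fin (n + 1) ≃ Unit ⊕ Fin n :=
      { toFun := Fin.cases (.inl ()) .inr
        invFun := Sum.elim (fun _ => 0) Fin.succ
        left_inv := fun i => by cases i using Fin.cases <;> simp
        right_inv := fun i => by rcases i with i | i <;> simp }
    let N' := N.submatrix (Equiv.swap 0 i') (Equiv.swap 0 j')
    have hN' : ∀ k l, N' 0 0 ∣ N' k l := fun k l => by
      simpa [N'] using hN _ _
    obtain ⟨D, hD⟩ := UnitEquiv.fromBlocks_of_dvd (N'.submatrix e.symm e.symm)
      (fun k l => hN' _ _)
    obtain ⟨d, hd, hDd⟩ := ih D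
    have hblock := hD.trans (UnitEquiv.fromBlocks _ hDd)
    have hdvd := hblock.dvd_apply (a := N' 0 0) (fun k l => hN' _ _)
    refine ⟨Fin.cons (N' 0 0) d, ?_, ?_⟩
    · intro k l hkl
      induction k using Fin.cases with
      | zero =>
        induction l using Fin.cases with
        | zero => simp
        | succ l => simpa using hdvd (.inr l) (.inr l)
      | succ k =>
        induction l using Fin.cases with
        | zero => simp at hkl
        | succ l => simpa using hd k l (by simpa using hkl)
    · refine (hMN.trans (.submatrix_perm N (Equiv.swap 0 i') (Equiv.swap 0 j'))).trans ?_
      have h := hblock.reindex e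
      convert h using 1
      · ext k l
        simp [N']
      · ext k l
        induction k using Fin.cases <;> induction l using Fin.cases <;>
          simp [e, Matrix.diagonal_apply, N', eq_comm]

lemma minorsSet_transpose {R : Type*} [CommRing R] {m n : ℕ} (M : Matrix (Fin m) (Fin n) R)
    (k : ℕ) : minorsSet M.transpose k = minorsSet M k := by
  ext x
  constructor
  · rintro ⟨ri, ci, hr, hc, rfl⟩
    exact ⟨ci, ri, hc, hr, by rw [← Matrix.det_transpose, Matrix.transpose_submatrix,
      Matrix.transpose_transpose]⟩
  · rintro ⟨ri, ci, hr, hc, rfl⟩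
    exact ⟨ci, ri, hc, hr, by rw [← Matrix.det_transpose, Matrix.transpose_submatrix]⟩

lemma dvd_minors_mul_left {R : Type*} [CommRing R] {m n l k : ℕ} {d : R}
    (P : Matrix (Fin l) (Fin m) R) {M : Matrix (Fin m) (Fin n) R}
    (h : ∀ x ∈ minorsSet M k, d ∣ x) : ∀ x ∈ minorsSet (P * M) k, d ∣ x := by
  rintro _ ⟨ri, ci, -, hc, rfl⟩
  have hrow : (P * M).submatrix ri ci =
      .of fun i => ∑ j, P (ri i) j • fun c => M j (ci c) := by
    ext i c
    simp [Matrix.mul_apply]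
  have hdet : ((P * M).submatrix ri ci).det =
      ∑ f : Fin k → Fin m, (∏ i, P (ri i) (f i)) • (M.submatrix f ci).det := by
    rw [hrow]
    change Matrix.detRowAlternating (fun i => ∑ j, P (ri i) j • fun c => M j (ci c)) = _
    rw [← AlternatingMap.coe_multilinearMap, MultilinearMap.map_sum]
    refine Finset.sum_congr rfl fun f _ => ?_
    rw [MultilinearMap.map_smul_univ]
    rfl
  rw [hdet]
  refine Finset.dvd_sum fun f _ => Dvd.dvd.mul_left ?_ _
  by_cases hf : Function.Injective f
  · exact h _ ⟨f, ci, hf, hc, rfl⟩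
  · obtain ⟨i, j, hij, hne⟩ : ∃ i j, f i = f j ∧ i ≠ j := by
      simpa [Function.Injective] using hf
    rw [Matrix.det_zero_of_row_eq hne (by ext c; simp [hij])]
    exact dvd_zero d

lemma dvd_minors_mul_right {R : Type*} [CommRing R] {m n l k : ℕ} {d : R}
    {M : Matrix (Fin m) (Fin n) R} (Q : Matrix (Fin n) (Fin l) R)
    (h : ∀ x ∈ minorsSet M k, d ∣ x) : ∀ x ∈ minorsSet (M * Q) k, d ∣ x := by
  rw [← minorsSet_transpose] at h ⊢
  rw [Matrix.transpose_mul]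
  exact dvd_minors_mul_left _ h

lemma UnitEquiv.dvd_minors {R : Type*} [CommRing R] {n k : ℕ} {d : R}
    {M N : Matrix (Fin n) (Fin n) R} (hMN : UnitEquiv M N)
    (h : ∀ x ∈ minorsSet M k, d ∣ x) : ∀ x ∈ minorsSet N k, d ∣ x := by
  obtain ⟨P, Q, rfl⟩ := hMN
  exact dvd_minors_mul_right _ (dvd_minors_mul_left _ h)

lemma UnitEquiv.isGCDOf_minors {R : Type*} [CommRing R] {n k : ℕ} {g : R}
    {M N : Matrix (Fin n) (Fin n) R} (hMN : UnitEquiv M N)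
    (h : IsGCDOf g (minorsSet M k)) : IsGCDOf g (minorsSet N k) :=
  ⟨hMN.dvd_minors h.1, fun d hd => h.2 d (hMN.symm.dvd_minors hd)⟩

lemma prod_range_dvd_prod_injective {R : Type*} [CommRing R] {n k : ℕ} {d : ℕ → R}
    (hd : ∀ i j, i ≤ j → j < n → d i ∣ d j) (c : Fin k → Fin n) (hc : Function.Injective c) :
    ∏ i ∈ Finset.range k, d i ∣ ∏ i, d (c i) := by
  have hcard : (Finset.univ.map ⟨c, hc⟩).card = k := by simp
  have hprod : ∏ i, d (c i) = ∏ i, d ((Finset.univ.map ⟨c, hc⟩).orderEmbOfFin hcard i) := by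
    calc ∏ i, d (c i) = ∏ j ∈ Finset.univ.map ⟨c, hc⟩, d j := by rw [Finset.prod_map]; rfl
      _ = _ := by
        conv_lhs => rw [← Finset.map_orderEmbOfFin_univ _ hcard]
        rw [Finset.prod_map]
        rfl
  rw [hprod, Finset.prod_range]
  refine Finset.prod_dvd_prod_of_dvd _ _ fun i _ => hd _ _ ?_ (Fin.is_lt _)
  set o := (Finset.univ.map ⟨c, hc⟩).orderEmbOfFin hcard
  have hmono : StrictMono fun i : Fin k => (o i : ℕ) := fun a b hab => o.strictMono hab
  obtain ⟨i, hi⟩ := i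
  induction i with
  | zero => exact Nat.zero_le _
  | succ i ih =>
    exact (ih (by omega) (Finset.mem_univ _)).trans_lt
      (hmono (show (⟨i, by omega⟩ : Fin k) < ⟨i + 1, hi⟩ by simp))

lemma isGCDOf_minors_diagonal {R : Type*} [CommRing R] {n k : ℕ} (hk : k ≤ n) {d : ℕ → R}
    (hd : ∀ i j, i ≤ j → j < n → d i ∣ d j) :
    IsGCDOf (∏ i ∈ Finset.range k, d i)
      (minorsSet (Matrix.diagonal fun i : Fin n => d i) k) := by
  constructor
  · rintro _ ⟨ri, ci, hr, hc, rfl⟩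
    rw [Matrix.det_apply]
    refine Finset.dvd_sum fun σ _ => dvd_smul_of_dvd _ ?_
    by_cases h : ∀ i, ri (σ i) = ci i
    · simp only [Matrix.submatrix_apply, h, Matrix.diagonal_apply_eq]
      exact prod_range_dvd_prod_injective hd ci hc
    · push Not at h
      obtain ⟨i, hi⟩ := h
      rw [Finset.prod_eq_zero (Finset.mem_univ i)]
      · exact dvd_zero _
      · rw [Matrix.submatrix_apply, Matrix.diagonal_apply_ne _ hi]
  · intro g hg
    refine hg _ ⟨Fin.castLE hk, Fin.castLE hk, Fin.castLE_injective hk,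
      Fin.castLE_injective hk, ?_⟩
    rw [Matrix.submatrix_diagonal _ _ (Fin.castLE_injective hk), Matrix.det_diagonal,
      Finset.prod_range]
    rfl

section Dehomogenize

open Polynomial

variable {F : Type*} [Field F] {n : ℕ}

/-- Setting `t = 1` in a polynomial in `s` and `t`. -/
noncomputable def dehomogenize : MvPolynomial (Fin 2) F →ₐ[F] F[X] :=
  MvPolynomial.aeval ![X, 1]

lemma homPencil_map_dehomogenize (G₀ G₁ : Matrix (Fin n) (Fin n) F) :
    (homPencil G₀ G₁).map dehomogenize = pencilOf G₀ G₁ := by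
  ext1 i j
  simp [homPencil, pencilOf, dehomogenize, Polynomial.C_eq_algebraMap]

lemma isHomogeneous_minor_homPencil (G₀ G₁ : Matrix (Fin n) (Fin n) F) {k : ℕ}
    {x : MvPolynomial (Fin 2) F} (hx : x ∈ minorsSet (homPencil G₀ G₁) k) :
    x.IsHomogeneous k := by
  obtain ⟨ri, ci, -, -, rfl⟩ := hx
  rw [Matrix.det_apply]
  refine MvPolynomial.IsHomogeneous.sum _ _ _ fun σ _ => ?_
  have hprod : (∏ i, (homPencil G₀ G₁).submatrix ri ci (σ i) i).IsHomogeneous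
      (∑ _i : Fin k, 1) := by
    refine MvPolynomial.IsHomogeneous.prod _ _ _ fun i _ => ?_
    have h := fun (c : F) (j : Fin 2) =>
      (MvPolynomial.isHomogeneous_X F j).mul (MvPolynomial.isHomogeneous_C (Fin 2) c)
    simpa [homPencil] using (h _ 1).add (h _ 0)
  simp only [Finset.sum_const, Finset.card_univ, Fintype.card_fin, smul_eq_mul, mul_one] at hprod
  rcases Int.units_eq_one_or (Equiv.Perm.sign σ) with h | h
  · simpa [h] using hprod
  · simpa [h] using hprod.neg

lemma homogenize_dvd_of_dvd_dehomogenize {x : MvPolynomial (Fin 2) F} {k : ℕ}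
    (hhom : x.IsHomogeneous k) {d : F[X]} (hd : d ∣ dehomogenize x) :
    d.homogenize d.natDegree ∣ x := by
  obtain ⟨q, hq⟩ := hd
  have hx : (dehomogenize x).homogenize k = x := homogenize_eq_of_isHomogeneous hhom rfl
  by_cases h0 : dehomogenize x = 0
  · rw [← hx, h0]; simp
  have hdeg : (dehomogenize x).natDegree ≤ k := by
    have := MvPolynomial.aeval_natDegree_le x hhom.totalDegree_le ![X, (1 : F[X])] (n := 1)
      (by intro i; fin_cases i <;> simp)
    simpa [dehomogenize] using this
  have hdq : d ≠ 0 ∧ q ≠ 0 := by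
    rw [hq] at h0; exact ⟨left_ne_zero_of_mul h0, right_ne_zero_of_mul h0⟩
  rw [hq, natDegree_mul hdq.1 hdq.2] at hdeg
  rw [← hx, hq, show k = d.natDegree + (k - d.natDegree) by omega,
    homogenize_mul _ _ le_rfl (by omega)]
  exact dvd_mul_right _ _

lemma isGCDOf_minors_pencilOf {G₀ G₁ : Matrix (Fin n) (Fin n) F} {k : ℕ}
    {D : MvPolynomial (Fin 2) F} (hD : IsGCDOf D (minorsSet (homPencil G₀ G₁) k)) :
    IsGCDOf (dehomogenize D) (minorsSet (pencilOf G₀ G₁) k) := by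
  have hdet (ri ci : Fin k → Fin n) : ((pencilOf G₀ G₁).submatrix ri ci).det =
      dehomogenize ((homPencil G₀ G₁).submatrix ri ci).det := by
    rw [← homPencil_map_dehomogenize, AlgHom.map_det]
    rfl
  constructor
  · rintro _ ⟨ri, ci, hr, hc, rfl⟩
    have hmem : ((homPencil G₀ G₁).submatrix ri ci).det ∈ minorsSet (homPencil G₀ G₁) k :=
      ⟨ri, ci, hr, hc, rfl⟩
    obtain ⟨q, hq⟩ := hD.1 _ hmem
    rw [hdet, hq, map_mul]
    exact dvd_mul_right _ _
  · intro d hd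
    have hd' : ∀ x ∈ minorsSet (homPencil G₀ G₁) k, d ∣ dehomogenize x := by
      rintro _ ⟨ri, ci, hr, hc, rfl⟩
      rw [← hdet]
      exact hd _ ⟨ri, ci, hr, hc, rfl⟩
    have hdvd : d.homogenize d.natDegree ∣ D := hD.2 _ fun x hx =>
      homogenize_dvd_of_dvd_dehomogenize (isHomogeneous_minor_homPencil G₀ G₁ hx) (hd' x hx)
    simpa [dehomogenize] using map_dvd (dehomogenize (F := F)) hdvd

lemma pencilOf_one_eq_charmatrix (A : Matrix (Fin n) (Fin n) F) :
    pencilOf A 1 = Matrix.charmatrix (-A) := by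
  ext1 i j
  by_cases h : i = j
  · subst h; simp [pencilOf, Matrix.charmatrix_apply_eq, add_comm]
  · simp [pencilOf, h]

lemma det_pencilOf_one_ne_zero (A : Matrix (Fin n) (Fin n) F) : (pencilOf A 1).det ≠ 0 := by
  rw [pencilOf_one_eq_charmatrix]
  exact (Matrix.charpoly_monic (-A)).ne_zero

lemma IsHomogeneousIF.unitEquiv_diagonal {A : Matrix (Fin n) (Fin n) F}
    {φ : ℕ → MvPolynomial (Fin 2) F} (hφ : IsHomogeneousIF A 1 φ) :
    UnitEquiv (pencilOf A 1) (Matrix.diagonal fun i : Fin n => dehomogenize (φ i)) := by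
  obtain ⟨d, hd, hAd⟩ := exists_unitEquiv_diagonal n (pencilOf A 1)
  let d' : ℕ → F[X] := fun i => if h : i < n then d ⟨i, h⟩ else 0
  have hdd' : d = fun i : Fin n => d' i := by ext1 i; simp [d']
  have hd' : ∀ i j, i ≤ j → j < n → d' i ∣ d' j := fun i j hij hj => by
    simpa [d', hj, hij.trans_lt hj] using hd ⟨i, hij.trans_lt hj⟩ ⟨j, hj⟩ hij
  have hassoc (k : ℕ) (hk : k ≤ n) : Associated (∏ i ∈ Finset.range k, d' i)
      (∏ i ∈ Finset.range k, dehomogenize (φ i)) := by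
    have h1 := hAd.symm.isGCDOf_minors (hdd' ▸ isGCDOf_minors_diagonal hk hd')
    have h2 := isGCDOf_minors_pencilOf (hφ k hk)
    rw [map_prod] at h2
    exact associated_of_dvd_dvd (h2.2 _ h1.1) (h1.2 _ h2.1)
  have hne : ∀ i < n, d' i ≠ 0 := by
    intro i hi h0
    have hdet : (Matrix.diagonal d).det = 0 := by
      rw [Matrix.det_diagonal, Finset.prod_eq_zero (Finset.mem_univ ⟨i, hi⟩)]
      simpa [d', hi] using h0
    obtain ⟨P, Q, hPQ⟩ := hAd
    rw [← hPQ, Matrix.det_mul, Matrix.det_mul] at hdet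
    have hP := ((Matrix.isUnit_iff_isUnit_det _).1 P.isUnit).ne_zero
    have hQ := ((Matrix.isUnit_iff_isUnit_det _).1 Q.isUnit).ne_zero
    exact mul_ne_zero (mul_ne_zero hP (det_pencilOf_one_ne_zero A)) hQ hdet
  have hfactor : ∀ i : Fin n, ∃ u : F[X]ˣ, (u : F[X]) * d i = dehomogenize (φ i) := by
    intro i
    have h1 := hassoc (i + 1) i.2
    rw [Finset.prod_range_succ, Finset.prod_range_succ] at h1
    obtain ⟨u, hu⟩ := h1.of_mul_left (hassoc i i.2.le)
      (Finset.prod_ne_zero_iff.2 fun j hj => hne j ((Finset.mem_range.1 hj).trans i.2))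
    exact ⟨u, by rw [← hu, hdd', mul_comm]⟩
  choose u hu using hfactor
  refine hAd.trans (.of_isUnit (P := Matrix.diagonal fun i => (u i : F[X])) (Q := 1) ?_
    isUnit_one ?_)
  · rw [Matrix.isUnit_iff_isUnit_det, Matrix.det_diagonal]
    exact ⟨∏ i, u i, by simp⟩
  · simp [hu]

end Dehomogenize

/-- Two endomorphisms are `r`-close if, after identifying the underlying spaces, they differ by
an endomorphism of rank at most `r`. -/
def RankClose {F V W : Type*} [Field F] [AddCommGroup V] [Module F V] [AddCommGroup W]
    [Module F W] (r : ℕ) (a : Module.End F V) (b : Module.End F W) : Prop :=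
  ∃ S : V ≃ₗ[F] W, (S.toLinearMap ∘ₗ a - b ∘ₗ S.toLinearMap).rank ≤ r

namespace RankClose

universe u

variable {F U V W : Type u} [Field F] [AddCommGroup U] [Module F U] [AddCommGroup V]
  [Module F V] [AddCommGroup W] [Module F W] {a : Module.End F U} {b : Module.End F V}
  {c : Module.End F W} {r s : ℕ}

lemma symm (h : RankClose r a b) : RankClose r b a := by
  obtain ⟨S, hS⟩ := h
  refine ⟨S.symm, ?_⟩
  have heq : S.symm.toLinearMap ∘ₗ b - a ∘ₗ S.symm.toLinearMap =
      -S.symm.toLinearMap ∘ₗ ((S.toLinearMap ∘ₗ a - b ∘ₗ S.toLinearMap) ∘ₗ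
        S.symm.toLinearMap) := by
    ext x
    simp
  rw [heq]
  exact (LinearMap.rank_comp_le_right _ (-S.symm.toLinearMap)).trans
    ((LinearMap.rank_comp_le_left S.symm.toLinearMap _).trans hS)

lemma trans (h₁ : RankClose r a b) (h₂ : RankClose s b c) : RankClose (r + s) a c := by
  obtain ⟨S, hS⟩ := h₁
  obtain ⟨T, hT⟩ := h₂
  refine ⟨S.trans T, ?_⟩
  have heq : (S.trans T).toLinearMap ∘ₗ a - c ∘ₗ (S.trans T).toLinearMap =
      T.toLinearMap ∘ₗ (S.toLinearMap ∘ₗ a - b ∘ₗ S.toLinearMap) +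
        (T.toLinearMap ∘ₗ b - c ∘ₗ T.toLinearMap) ∘ₗ S.toLinearMap := by
    ext x
    simp
  rw [heq, Nat.cast_add]
  exact (LinearMap.rank_add_le _ _).trans (add_le_add
    ((LinearMap.rank_comp_le_right _ _).trans hS) ((LinearMap.rank_comp_le_left _ _).trans hT))

lemma of_comp_eq (S : U ≃ₗ[F] V) (h : ∀ x, S (a x) = b (S x)) : RankClose 0 a b := by
  refine ⟨S, ?_⟩
  rw [show S.toLinearMap ∘ₗ a - b ∘ₗ S.toLinearMap = 0 by ext x; simp [h]]
  simp

/-- Endomorphisms which are given by the same formula on the kernel of a functional are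
`1`-close. -/
lemma of_eq_on_ker (Φ : W ≃ₗ[F] U) (Ψ : W ≃ₗ[F] V) (l : W →ₗ[F] F)
    (h : ∀ x, l x = 0 → ∃ y, a (Φ x) = Φ y ∧ b (Ψ x) = Ψ y) : RankClose 1 a b := by
  refine ⟨Φ.symm.trans Ψ, ?_⟩
  set T := (Φ.symm.trans Ψ).toLinearMap ∘ₗ a - b ∘ₗ (Φ.symm.trans Ψ).toLinearMap with hT
  have hker : ∀ x, l x = 0 → T (Φ x) = 0 := by
    intro x hx
    obtain ⟨y, hy, hy'⟩ := h x hx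
    simp [hT, hy, hy']
  obtain ⟨t, ht⟩ : ∃ t : F →ₗ[F] V, T = t ∘ₗ (l ∘ₗ Φ.symm.toLinearMap) := by
    by_cases hl : ∃ e, l e = 1
    · obtain ⟨e, he⟩ := hl
      refine ⟨LinearMap.toSpanSingleton F V (T (Φ e)), LinearMap.ext fun x => ?_⟩
      have := hker (Φ.symm x - l (Φ.symm x) • e) (by simp [he])
      rw [map_sub, map_sub, Φ.apply_symm_apply, sub_eq_zero] at this
      simp [this]
    · refine ⟨0, LinearMap.ext fun x => ?_⟩
      have hl0 : l (Φ.symm x) = 0 := by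
        by_contra h0
        exact hl ⟨(l (Φ.symm x))⁻¹ • Φ.symm x, by simp [h0]⟩
      simpa using hker _ hl0
  rw [ht]
  refine ((LinearMap.rank_comp_le_right _ _).trans (Submodule.rank_le _)).trans ?_
  simp

end RankClose

section CyclicSum

open Polynomial

variable {F : Type*} [Field F] {n : ℕ}

/-- The torsion `F[X]`-module `⨁ i < n, F[X] / (f i)`. -/
def CyclicSum (n : ℕ) (f : ℕ → F[X]) : Type _ :=
  (i : Fin n) → F[X] ⧸ Ideal.span {f i}

noncomputable instance (f : ℕ → F[X]) : AddCommGroup (CyclicSum n f) :=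
  inferInstanceAs (AddCommGroup ((i : Fin n) → F[X] ⧸ Ideal.span {f i}))

noncomputable instance (f : ℕ → F[X]) : Module F[X] (CyclicSum n f) :=
  inferInstanceAs (Module F[X] ((i : Fin n) → F[X] ⧸ Ideal.span {f i}))

noncomputable instance (f : ℕ → F[X]) : Module F (CyclicSum n f) :=
  inferInstanceAs (Module F ((i : Fin n) → F[X] ⧸ Ideal.span {f i}))

instance (f : ℕ → F[X]) : IsScalarTower F F[X] (CyclicSum n f) :=
  inferInstanceAs (IsScalarTower F F[X] ((i : Fin n) → F[X] ⧸ Ideal.span {f i}))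

/-- Multiplication by `X` on `⨁ i < n, F[X] / (f i)`. -/
noncomputable def CyclicSum.mulX (n : ℕ) (f : ℕ → F[X]) : Module.End F (CyclicSum n f) :=
  (LinearMap.lsmul F[X] (CyclicSum n f) X).restrictScalars F

lemma finite_quotient_span_singleton {p : F[X]} (hp : p ≠ 0) :
    Module.Finite F (F[X] ⧸ Ideal.span {p}) :=
  (AdjoinRoot.powerBasis hp).finite

lemma CyclicSum.finite {f : ℕ → F[X]} (hf : ∀ i < n, f i ≠ 0) :
    Module.Finite F (CyclicSum n f) := by
  have := fun i : Fin n => finite_quotient_span_singleton (hf i i.2)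
  exact inferInstanceAs (Module.Finite F ((i : Fin n) → F[X] ⧸ Ideal.span {f i}))

lemma CyclicSum.finrank {f : ℕ → F[X]} (hf : ∀ i < n, f i ≠ 0) :
    Module.finrank F (CyclicSum n f) = ∑ i ∈ Finset.range n, (f i).natDegree := by
  have := fun i : Fin n => finite_quotient_span_singleton (hf i i.2)
  refine (Module.finrank_pi_fintype F (M := fun i : Fin n => F[X] ⧸ Ideal.span {f i})).trans ?_
  rw [Finset.sum_range]
  exact Finset.sum_congr rfl fun i _ => finrank_quotient_span_eq_natDegree

/-- The inclusion of the `i`-th summand, precomposed with the quotient map. -/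
noncomputable def CyclicSum.single (f : ℕ → F[X]) (i : Fin n) : F[X] →ₗ[F[X]] CyclicSum n f :=
  LinearMap.single F[X] (fun i : Fin n => F[X] ⧸ Ideal.span {f i}) i ∘ₗ
    Submodule.mkQ (Ideal.span {f i})

/-- The `i`-th standard generator of `⨁ i < n, F[X] / (f i)`. -/
noncomputable def CyclicSum.gen (f : ℕ → F[X]) (i : Fin n) : CyclicSum n f :=
  CyclicSum.single f i 1

lemma CyclicSum.smul_gen (f : ℕ → F[X]) (i : Fin n) (c : F[X]) :
    c • CyclicSum.gen f i = CyclicSum.single f i c := by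
  rw [gen, ← map_smul, smul_eq_mul, mul_one]

lemma CyclicSum.smul_gen_self (f : ℕ → F[X]) (i : Fin n) :
    f i • CyclicSum.gen f i = 0 := by
  rw [smul_gen]
  exact (congrArg (LinearMap.single F[X] (fun i : Fin n => F[X] ⧸ Ideal.span {f i}) i)
    ((Submodule.Quotient.mk_eq_zero _).2 (Ideal.mem_span_singleton_self _))).trans (map_zero _)

lemma CyclicSum.eq_sum_smul_gen (f : ℕ → F[X]) (x : CyclicSum n f) :
    ∃ c : Fin n → F[X], x = ∑ i, c i • CyclicSum.gen f i := by
  choose c hc using fun i : Fin n => Submodule.mkQ_surjective (Ideal.span {f i}) (x i)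
  refine ⟨c, (Finset.univ_sum_single x).symm.trans (Finset.sum_congr rfl fun i _ => ?_)⟩
  rw [smul_gen, ← hc]
  rfl

lemma CyclicSum.exists_linearMap {M : Type*} [AddCommGroup M] [Module F[X] M] {f : ℕ → F[X]}
    (v : Fin n → M) (hv : ∀ i : Fin n, f i • v i = 0) :
    ∃ L : CyclicSum n f →ₗ[F[X]] M, ∀ i, L (CyclicSum.gen f i) = v i := by
  let l (i : Fin n) : (F[X] ⧸ Ideal.span {f i}) →ₗ[F[X]] M :=
    Submodule.liftQSpanSingleton (f i) (LinearMap.toSpanSingleton F[X] M (v i))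
      (by simpa using hv i)
  refine ⟨LinearMap.lsum F[X] (fun i : Fin n => F[X] ⧸ Ideal.span {f i}) F[X] l, fun i => ?_⟩
  refine (LinearMap.lsum_piSingle _ _ _ _ _ _).trans ?_
  exact (Submodule.liftQSpanSingleton_apply ..).trans (by simp)

/-- If the `f i` and `ω i` interlace, then `⨁ F[X] / (f i)` is obtained from `⨁ F[X] / (ω i)`
by adjoining a vector whose multiples by polynomials of degree less than `d` are independent. -/
lemma CyclicSum.exists_equiv_prod_degreeLT {m d : ℕ} {f ω : ℕ → F[X]}
    (hf : ∀ i ≤ m, f i ≠ 0) (hfω : ∀ i < m, f i ∣ ω i) (hωf : ∀ i < m, ω i ∣ f (i + 1))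
    (hd : d + ∑ i ∈ Finset.range m, (ω i).natDegree =
      ∑ i ∈ Finset.range (m + 1), (f i).natDegree) :
    ∃ Φ : (CyclicSum m ω × degreeLT F d) ≃ₗ[F] CyclicSum (m + 1) f,
      ∀ x y : CyclicSum m ω × degreeLT F d, (X : F[X]) • x.1 = y.1 →
        (X : F[X]) * x.2 = y.2 → (X : F[X]) • Φ x = Φ y := by
  have hf' : ∀ i < m + 1, f i ≠ 0 := fun i hi => hf i (by omega)
  choose! h hh using hωf
  have hω : ∀ i < m, ω i ≠ 0 := fun i hi h0 => hf (i + 1) hi (by rw [hh i hi, h0, zero_mul])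
  have hh0 : ∀ i < m, h i ≠ 0 := fun i hi h0 => hf (i + 1) hi (by rw [hh i hi, h0, mul_zero])
  obtain ⟨ι, hι⟩ := CyclicSum.exists_linearMap (f := ω)
    (fun i : Fin m => CyclicSum.gen f i.castSucc - h i • CyclicSum.gen f i.succ) (by
      intro i
      obtain ⟨c, hc⟩ := hfω i i.2
      have h1 := CyclicSum.smul_gen_self f i.castSucc
      have h2 := CyclicSum.smul_gen_self f i.succ
      rw [Fin.val_castSucc] at h1
      rw [Fin.val_succ, hh i i.2] at h2
      rw [smul_sub, smul_smul, h2, hc, mul_comm, mul_smul, h1]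
      simp)
  have hchain (k : ℕ) (hk : k ≤ m) : (f 0 * ∏ i ∈ Finset.range k, h i) •
      CyclicSum.gen f (⟨k, by omega⟩ : Fin (m + 1)) ∈ LinearMap.range ι := by
    induction k with
    | zero => exact ⟨0, by simpa using (CyclicSum.smul_gen_self f (0 : Fin (m + 1))).symm⟩
    | succ k ih =>
      have h1 := hι ⟨k, hk⟩
      have h2 := ih (by omega)
      have heq : (f 0 * ∏ i ∈ Finset.range (k + 1), h i) •
          CyclicSum.gen f (⟨k + 1, by omega⟩ : Fin (m + 1)) =
          (f 0 * ∏ i ∈ Finset.range k, h i) • CyclicSum.gen f (⟨k, by omega⟩ : Fin (m + 1)) -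
          (f 0 * ∏ i ∈ Finset.range k, h i) • ι (CyclicSum.gen ω ⟨k, hk⟩) := by
        rw [h1, smul_sub, Finset.prod_range_succ, ← mul_assoc, mul_smul]
        simp
      rw [heq]
      exact sub_mem h2 (Submodule.smul_mem _ _ ⟨_, rfl⟩)
  set p := f 0 * ∏ i ∈ Finset.range m, h i with hp
  have hp0 : p ≠ 0 := mul_ne_zero (hf 0 (by omega))
    (Finset.prod_ne_zero_iff.2 fun i hi => hh0 i (Finset.mem_range.1 hi))
  have hpd : p.natDegree = d := by
    have hprod : p * ∏ i ∈ Finset.range m, ω i = ∏ i ∈ Finset.range (m + 1), f i := by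
      rw [Finset.prod_range_succ', hp, mul_assoc, ← Finset.prod_mul_distrib, mul_comm]
      congr 1
      exact Finset.prod_congr rfl fun i hi => by rw [hh i (Finset.mem_range.1 hi), mul_comm]
    have hdeg := congrArg natDegree hprod
    rw [natDegree_mul hp0 (Finset.prod_ne_zero_iff.2 fun i hi => hω i (Finset.mem_range.1 hi)),
      natDegree_prod _ _ fun i hi => hω i (Finset.mem_range.1 hi),
      natDegree_prod _ _ fun i hi => hf' i (Finset.mem_range.1 hi)] at hdeg
    omega
  let e := CyclicSum.gen f (Fin.last m)
  let Φ : (CyclicSum m ω × degreeLT F d) →ₗ[F] CyclicSum (m + 1) f :=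
    (ι.restrictScalars F).coprod
      ((LinearMap.toSpanSingleton F[X] _ e).restrictScalars F ∘ₗ (degreeLT F d).subtype)
  have hΦ (x : CyclicSum m ω × degreeLT F d) : Φ x = ι x.1 + (x.2 : F[X]) • e := by
    simp [Φ]
  have hιΦ (u : CyclicSum m ω) : ι u ∈ LinearMap.range Φ := ⟨(u, 0), by simp [hΦ]⟩
  have heΦ (q : F[X]) : q • e ∈ LinearMap.range Φ := by
    obtain ⟨y, hy⟩ := hchain m le_rfl
    have hmod : q % p ∈ degreeLT F d := by
      rw [mem_degreeLT, ← hpd, ← degree_eq_natDegree hp0]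
      exact degree_mod_lt _ hp0
    refine ⟨((q / p) • y, ⟨q % p, hmod⟩), ?_⟩
    rw [hΦ, map_smul, hy]
    change (q / p) • p • e + (q % p) • e = _
    rw [smul_smul, ← add_smul]
    congr 1
    rw [mul_comm]
    exact EuclideanDomain.div_add_mod q p
  have hgenΦ (i : Fin (m + 1)) : ∀ q : F[X], q • CyclicSum.gen f i ∈ LinearMap.range Φ := by
    induction i using Fin.reverseInduction with
    | last => exact heΦ
    | cast i ih =>
      intro q
      have heq : q • CyclicSum.gen f i.castSucc =
          ι (q • CyclicSum.gen ω i) + (q * h i) • CyclicSum.gen f i.succ := by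
        rw [map_smul, hι, smul_sub, mul_smul, sub_add_cancel]
      rw [heq]
      exact add_mem (hιΦ _) (ih _)
  have hsurj : Function.Surjective Φ := by
    intro x
    obtain ⟨c, rfl⟩ := CyclicSum.eq_sum_smul_gen f x
    exact sum_mem (S := LinearMap.range Φ) fun i _ => hgenΦ i (c i)
  have := CyclicSum.finite hω
  have := CyclicSum.finite hf'
  have : Module.Finite F (degreeLT F d) := .equiv (degreeLTEquiv F d).symm
  have hfinrank : Module.finrank F (CyclicSum m ω × degreeLT F d) =
      Module.finrank F (CyclicSum (m + 1) f) := by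
    rw [Module.finrank_prod, CyclicSum.finrank hω,
      CyclicSum.finrank hf',
      (degreeLTEquiv F d).finrank_eq, Module.finrank_fin_fun, ← hd, add_comm]
  have hbij : Function.Bijective Φ :=
    ⟨(LinearMap.injective_iff_surjective_of_finrank_eq_finrank hfinrank).2 hsurj, hsurj⟩
  refine ⟨.ofBijective Φ hbij, fun x y h1 h2 => ?_⟩
  change (X : F[X]) • Φ x = Φ y
  rw [hΦ, hΦ, ← h1, ← h2, map_smul, smul_add, mul_smul]

/-- Two interlacing divisor chains of the same total degree give `1`-close endomorphisms. -/
lemma CyclicSum.rankClose_one {f g : ℕ → F[X]} (hn : n ≠ 0)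
    (hf : ∀ i < n, f i ≠ 0) (hg : ∀ i < n, g i ≠ 0)
    (hff : ∀ i, i + 1 < n → f i ∣ f (i + 1)) (hgg : ∀ i, i + 1 < n → g i ∣ g (i + 1))
    (hfg : ∀ i, i + 1 < n → f i ∣ g (i + 1)) (hgf : ∀ i, i + 1 < n → g i ∣ f (i + 1))
    (hdeg : ∑ i ∈ Finset.range n, (f i).natDegree = ∑ i ∈ Finset.range n, (g i).natDegree) :
    RankClose 1 (CyclicSum.mulX n f) (CyclicSum.mulX n g) := by
  classical
  cases n with
  | zero => exact absurd rfl hn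
  | succ m =>
    let ω : ℕ → F[X] := fun i => EuclideanDomain.lcm (f i) (g i)
    have hωf : ∀ i < m, ω i ∣ f (i + 1) := fun i hi =>
      EuclideanDomain.lcm_dvd (hff i (by omega)) (hgf i (by omega))
    have hωg : ∀ i < m, ω i ∣ g (i + 1) := fun i hi =>
      EuclideanDomain.lcm_dvd (hfg i (by omega)) (hgg i (by omega))
    have hle : ∑ i ∈ Finset.range m, (ω i).natDegree ≤
        ∑ i ∈ Finset.range (m + 1), (f i).natDegree := by
      rw [Finset.sum_range_succ']
      exact (Finset.sum_le_sum fun i hi => natDegree_le_of_dvd (hωf i (Finset.mem_range.1 hi))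
        (hf _ (by simpa using hi))).trans (Nat.le_add_right _ _)
    obtain ⟨d, hd⟩ := Nat.exists_eq_add_of_le hle
    obtain ⟨Φ, hΦ⟩ := CyclicSum.exists_equiv_prod_degreeLT (fun i hi => hf i (by omega))
      (fun i _ => EuclideanDomain.dvd_lcm_left _ _) hωf (by rw [hd, add_comm])
    obtain ⟨Ψ, hΨ⟩ := CyclicSum.exists_equiv_prod_degreeLT (fun i hi => hg i (by omega))
      (fun i _ => EuclideanDomain.dvd_lcm_right _ _) hωg (by rw [← hdeg, hd, add_comm])
    refine RankClose.of_eq_on_ker Φ Ψ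
      (lcoeff F (d - 1) ∘ₗ (degreeLT F d).subtype ∘ₗ LinearMap.snd F _ _) fun x hx => ?_
    have hX : (X : F[X]) * x.2 ∈ degreeLT F d := by
      have hx2 := mem_degreeLT.1 x.2.2
      have hx' : (x.2 : F[X]).coeff (d - 1) = 0 := by simpa using hx
      rw [mem_degreeLT, degree_lt_iff_coeff_zero]
      intro k hk
      cases k with
      | zero => simp
      | succ k =>
        rw [coeff_X_mul]
        rcases eq_or_ne k (d - 1) with rfl | hk'
        · exact hx'
        · exact (degree_lt_iff_coeff_zero _ _).1 hx2 k (by omega)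
    exact ⟨((X : F[X]) • x.1, ⟨_, hX⟩), hΦ _ _ rfl rfl, hΨ _ _ rfl rfl⟩

end CyclicSum

lemma Finset.sum_range_ite_le {n p : ℕ} :
    ∑ i ∈ Finset.range n, (if p ≤ i then 1 else 0) = n - p := by
  induction n with
  | zero => simp
  | succ n ih =>
    rw [Finset.sum_range_succ, ih]
    split_ifs <;> omega

lemma exists_forall_lt_iff_le_of_monotone {n : ℕ} {a : ℕ → ℕ}
    (ha : ∀ i j, i ≤ j → j < n → a i ≤ a j) (m : ℕ) :
    ∃ p ≤ n, ∀ i < n, m < a i ↔ p ≤ i := by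
  classical
  have hex : ∃ p, p < n → m < a p := ⟨n, fun h => absurd h (lt_irrefl _)⟩
  refine ⟨Nat.find hex, Nat.find_min' hex fun h => absurd h (lt_irrefl _), fun i hi => ?_⟩
  refine ⟨fun h => Nat.find_min' hex fun _ => h, fun h => ?_⟩
  exact (Nat.find_spec hex (h.trans_lt hi)).trans_le (ha _ _ h hi)

lemma sum_range_eq_sum_layers {n M : ℕ} {a : ℕ → ℕ} (ha : ∀ i < n, a i ≤ M) :
    ∑ i ∈ Finset.range n, a i =
      ∑ m ∈ Finset.range M, ∑ i ∈ Finset.range n, (if m < a i then 1 else 0) := by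
  rw [Finset.sum_comm]
  refine Finset.sum_congr rfl fun i hi => ?_
  have hi := ha i (Finset.mem_range.1 hi)
  rw [← Finset.sum_filter, Finset.sum_const, smul_eq_mul, mul_one]
  have : (Finset.range M).filter (· < a i) = Finset.range (a i) := by
    ext m
    simp only [Finset.mem_filter, Finset.mem_range]
    omega
  rw [this, Finset.card_range]

/-- The weighted average inequality for the sequence which is interpolated between two
monotone sequences that interlace with shift `r + 1`. -/
lemma sum_max_shift_le {n r : ℕ} {a b c : ℕ → ℕ}
    (ha : ∀ i j, i ≤ j → j < n → a i ≤ a j) (hb : ∀ i j, i ≤ j → j < n → b i ≤ b j)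
    (hab : ∀ j, j + (r + 1) < n → a j ≤ b (j + (r + 1)))
    (hba : ∀ j, j + (r + 1) < n → b j ≤ a (j + (r + 1)))
    (hc : ∀ i < n, c i ≤ max (if 1 ≤ i then a (i - 1) else 0) (if r ≤ i then b (i - r) else 0)) :
    (r + 1) * ∑ i ∈ Finset.range n, c i ≤
      r * ∑ i ∈ Finset.range n, a i + ∑ i ∈ Finset.range n, b i := by
  let M := ∑ i ∈ Finset.range n, (a i + b i + c i)
  have hM : ∀ i < n, a i + b i + c i ≤ M := fun i hi =>
    Finset.single_le_sum (f := fun i => a i + b i + c i) (fun _ _ => Nat.zero_le _)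
      (Finset.mem_range.2 hi)
  rw [sum_range_eq_sum_layers (M := M) (a := a) fun i hi => by have := hM i hi; omega,
    sum_range_eq_sum_layers (M := M) (a := b) fun i hi => by have := hM i hi; omega,
    sum_range_eq_sum_layers (M := M) (a := c) fun i hi => by have := hM i hi; omega,
    Finset.mul_sum, Finset.mul_sum, ← Finset.sum_add_distrib]
  refine Finset.sum_le_sum fun m _ => ?_
  obtain ⟨p, hpn, hp⟩ := exists_forall_lt_iff_le_of_monotone ha m
  obtain ⟨q, hqn, hq⟩ := exists_forall_lt_iff_le_of_monotone hb m
  have hpq : q ≤ p + (r + 1) := by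
    by_contra! h
    have h1 := (hp p (by omega)).2 le_rfl
    have h2 := (hq _ (by omega)).1 (h1.trans_le (hab p (by omega)))
    omega
  have hqp : p ≤ q + (r + 1) := by
    by_contra! h
    have h1 := (hq q (by omega)).2 le_rfl
    have h2 := (hp _ (by omega)).1 (h1.trans_le (hba q (by omega)))
    omega
  have hsa : ∑ i ∈ Finset.range n, (if m < a i then 1 else 0) = n - p := by
    rw [← Finset.sum_range_ite_le]
    exact Finset.sum_congr rfl fun i hi => by simp only [hp i (Finset.mem_range.1 hi)]
  have hsb : ∑ i ∈ Finset.range n, (if m < b i then 1 else 0) = n - q := by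
    rw [← Finset.sum_range_ite_le]
    exact Finset.sum_congr rfl fun i hi => by simp only [hq i (Finset.mem_range.1 hi)]
  have hsc : ∑ i ∈ Finset.range n, (if m < c i then 1 else 0) ≤ n - min (p + 1) (q + r) := by
    rw [← Finset.sum_range_ite_le]
    refine Finset.sum_le_sum fun i hi => ?_
    have hi := Finset.mem_range.1 hi
    have h1 : m < c i → min (p + 1) (q + r) ≤ i := by
      intro hmc
      have h2 := hmc.trans_le (hc i hi)
      rw [lt_max_iff] at h2
      rcases h2 with h2 | h2
      · split_ifs at h2 with h3
        · have := (hp _ (by omega)).1 h2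
          omega
        · omega
      · split_ifs at h2 with h3
        · have := (hq _ (by omega)).1 h2
          omega
        · omega
    split_ifs <;> simp_all
  rw [hsa, hsb]
  refine (Nat.mul_le_mul_left _ hsc).trans ?_
  obtain ⟨α, rfl⟩ := Nat.exists_eq_add_of_le hpn
  rcases le_total (p + 1) (q + r) with h | h
  · rw [min_eq_left h]
    rcases Nat.eq_zero_or_pos α with rfl | hα
    · simp
    · obtain ⟨α, rfl⟩ := Nat.exists_eq_add_of_le' hα
      rw [show p + (α + 1) - (p + 1) = α by omega, show p + (α + 1) - p = α + 1 by omega]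
      have : α ≤ r + (p + (α + 1) - q) := by omega
      nlinarith
  · rw [min_eq_right h]
    rcases Nat.le_total (p + α) (q + r) with h' | h'
    · simp [Nat.sub_eq_zero_of_le h']
    · obtain ⟨β, hβ⟩ := Nat.exists_eq_add_of_le h'
      rw [show p + α - (q + r) = β by omega, show p + α - p = α by omega,
        show p + α - q = r + β by omega]
      have : β ≤ α + 1 := by omega
      nlinarith

lemma Prime.multiplicity_lcm_le {R : Type*} [EuclideanDomain R] [DecidableEq R] {p a b : R}
    (hp : Prime p) (ha : a ≠ 0) (hb : b ≠ 0) :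
    multiplicity p (EuclideanDomain.lcm a b) ≤ max (multiplicity p a) (multiplicity p b) := by
  obtain ⟨a', ha', hpa⟩ :=
    (FiniteMultiplicity.of_prime_left hp ha).exists_eq_pow_mul_and_not_dvd
  obtain ⟨b', hb', hpb⟩ :=
    (FiniteMultiplicity.of_prime_left hp hb).exists_eq_pow_mul_and_not_dvd
  set s := multiplicity p a
  set t := multiplicity p b
  have hdvd : EuclideanDomain.lcm a b ∣ p ^ max s t * (a' * b') := by
    refine EuclideanDomain.lcm_dvd ?_ ?_
    · rw [ha']
      exact mul_dvd_mul (pow_dvd_pow _ (le_max_left _ _)) (dvd_mul_right _ _)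
    · rw [hb']
      exact mul_dvd_mul (pow_dvd_pow _ (le_max_right _ _)) (dvd_mul_left _ _)
  by_contra! h
  have h1 : p ^ (max s t + 1) ∣ p ^ max s t * (a' * b') :=
    ((pow_dvd_pow p h).trans (pow_multiplicity_dvd _ _)).trans hdvd
  rw [pow_succ] at h1
  rcases hp.dvd_or_dvd ((mul_dvd_mul_iff_left (pow_ne_zero _ hp.ne_zero)).1 h1) with h2 | h2
  · exact hpa h2
  · exact hpb h2

section DivisorChain

open Polynomial

variable {F : Type*} [Field F] {n : ℕ}

/-- `f 0 ∣ f 1 ∣ ⋯ ∣ f (n - 1)` are nonzero polynomials whose product has degree `N`. -/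
structure IsDivisorChain (n N : ℕ) (f : ℕ → F[X]) : Prop where
  ne_zero : ∀ i < n, f i ≠ 0
  dvd_succ : ∀ i, i + 1 < n → f i ∣ f (i + 1)
  sum_natDegree : ∑ i ∈ Finset.range n, (f i).natDegree = N

lemma IsDivisorChain.dvd {N : ℕ} {f : ℕ → F[X]} (hf : IsDivisorChain n N f) {i j : ℕ}
    (hij : i ≤ j) (hj : j < n) : f i ∣ f j := by
  induction j, hij using Nat.le_induction with
  | base => rfl
  | succ j hij ih => exact (ih (by omega)).trans (hf.dvd_succ j hj)

lemma IsDivisorChain.multiplicity_le {N : ℕ} {f : ℕ → F[X]} (hf : IsDivisorChain n N f)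
    {p : F[X]} (hp : Prime p) {q : F[X]} {j : ℕ} (hq : q ∣ f j) (hj : j < n) :
    multiplicity p q ≤ multiplicity p (f j) :=
  (FiniteMultiplicity.of_prime_left hp (hf.ne_zero j hj)).le_multiplicity_of_pow_dvd
    ((pow_multiplicity_dvd p q).trans hq)

open scoped Classical in
/-- The chain interpolating between `f` and `g`, up to a correction of the last entry. -/
noncomputable def shiftLcm (r : ℕ) (f g : ℕ → F[X]) (i : ℕ) : F[X] :=
  EuclideanDomain.lcm (if 1 ≤ i then f (i - 1) else 1) (if r ≤ i then g (i - r) else 1)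

lemma dvd_shiftLcm_succ (r : ℕ) (f g : ℕ → F[X]) (i : ℕ) : f i ∣ shiftLcm r f g (i + 1) := by
  classical
  rw [shiftLcm, if_pos (Nat.le_add_left 1 i), Nat.add_sub_cancel]
  exact EuclideanDomain.dvd_lcm_left _ _

lemma dvd_shiftLcm_add (r : ℕ) (f g : ℕ → F[X]) (i : ℕ) : g i ∣ shiftLcm r f g (i + r) := by
  classical
  rw [shiftLcm, if_pos (Nat.le_add_left r i), Nat.add_sub_cancel]
  exact EuclideanDomain.dvd_lcm_right _ _

lemma shiftLcm_dvd {r : ℕ} {f g : ℕ → F[X]} {i : ℕ} {p : F[X]}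
    (hf : 1 ≤ i → f (i - 1) ∣ p) (hg : r ≤ i → g (i - r) ∣ p) : shiftLcm r f g i ∣ p := by
  classical
  refine EuclideanDomain.lcm_dvd ?_ ?_
  · split_ifs with h
    exacts [hf h, one_dvd p]
  · split_ifs with h
    exacts [hg h, one_dvd p]

lemma shiftLcm_ne_zero {r N N' : ℕ} {f g : ℕ → F[X]} (hf : IsDivisorChain n N f)
    (hg : IsDivisorChain n N' g) {i : ℕ} (hi : i < n) : shiftLcm r f g i ≠ 0 := by
  classical
  rw [shiftLcm, Ne, EuclideanDomain.lcm_eq_zero_iff, not_or]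
  constructor
  · split_ifs
    exacts [hf.ne_zero _ (by omega), one_ne_zero]
  · split_ifs
    exacts [hg.ne_zero _ (by omega), one_ne_zero]

lemma sum_natDegree_shiftLcm_le {r N : ℕ} {f g : ℕ → F[X]} (hf : IsDivisorChain n N f)
    (hg : IsDivisorChain n N g) (hfg : ∀ j, j + (r + 1) < n → f j ∣ g (j + (r + 1)))
    (hgf : ∀ j, j + (r + 1) < n → g j ∣ f (j + (r + 1))) :
    ∑ i ∈ Finset.range n, (shiftLcm r f g i).natDegree ≤ N := by
  classical
  have hf0 := fun i (hi : i ∈ Finset.range n) => hf.ne_zero i (Finset.mem_range.1 hi)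
  have hg0 := fun i (hi : i ∈ Finset.range n) => hg.ne_zero i (Finset.mem_range.1 hi)
  have hc0 := fun i (hi : i ∈ Finset.range n) =>
    shiftLcm_ne_zero (r := r) hf hg (Finset.mem_range.1 hi)
  have hsum {p : F[X]} (hp : Prime p) {c : ℕ → F[X]} (hc : ∀ i ∈ Finset.range n, c i ≠ 0) :
      emultiplicity p (∏ i ∈ Finset.range n, c i) =
        ((∑ i ∈ Finset.range n, multiplicity p (c i) : ℕ) : ℕ∞) := by
    rw [Finset.emultiplicity_prod hp, Nat.cast_sum]
    exact Finset.sum_congr rfl fun i hi =>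
      (FiniteMultiplicity.of_prime_left hp (hc i hi)).emultiplicity_eq_multiplicity
  have hdvd : (∏ i ∈ Finset.range n, shiftLcm r f g i) ^ (r + 1) ∣
      (∏ i ∈ Finset.range n, f i) ^ r * ∏ i ∈ Finset.range n, g i := by
    rw [UniqueFactorizationMonoid.dvd_iff_emultiplicity_le
      (pow_ne_zero _ (Finset.prod_ne_zero_iff.2 hc0))]
    intro p hp
    rw [emultiplicity_mul hp, emultiplicity_pow hp, emultiplicity_pow hp, hsum hp hf0,
      hsum hp hg0, hsum hp hc0]
    norm_cast
    refine sum_max_shift_le (fun i j hij hj => hf.multiplicity_le hp (hf.dvd hij hj) hj)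
      (fun i j hij hj => hg.multiplicity_le hp (hg.dvd hij hj) hj)
      (fun j hj => hg.multiplicity_le hp (hfg j hj) hj)
      (fun j hj => hf.multiplicity_le hp (hgf j hj) hj) fun i hi => ?_
    refine (hp.multiplicity_lcm_le ?_ ?_).trans (max_le_max ?_ ?_)
    · split_ifs
      exacts [hf.ne_zero _ (by omega), one_ne_zero]
    · split_ifs
      exacts [hg.ne_zero _ (by omega), one_ne_zero]
    · split_ifs
      · rfl
      · simp [multiplicity_eq_zero, hp.not_dvd_one]
    · split_ifs
      · rfl
      · simp [multiplicity_eq_zero, hp.not_dvd_one]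
  have hdeg := natDegree_le_of_dvd hdvd
    (mul_ne_zero (pow_ne_zero _ (Finset.prod_ne_zero_iff.2 hf0)) (Finset.prod_ne_zero_iff.2 hg0))
  rw [natDegree_mul (pow_ne_zero _ (Finset.prod_ne_zero_iff.2 hf0))
    (Finset.prod_ne_zero_iff.2 hg0), natDegree_pow, natDegree_pow, natDegree_prod _ _ hf0,
    natDegree_prod _ _ hg0, natDegree_prod _ _ hc0, hf.sum_natDegree, hg.sum_natDegree] at hdeg
  exact Nat.le_of_mul_le_mul_left (by linarith) (Nat.succ_pos r)

/-- Divisor chains that interlace with shift `r + 1` admit an intermediate chain. -/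
lemma IsDivisorChain.exists_intermediate {r N : ℕ} (hr : r ≠ 0) {f g : ℕ → F[X]}
    (hn : n ≠ 0) (hf : IsDivisorChain n N f)
    (hg : IsDivisorChain n N g) (hfg : ∀ j, j + (r + 1) < n → f j ∣ g (j + (r + 1)))
    (hgf : ∀ j, j + (r + 1) < n → g j ∣ f (j + (r + 1))) :
    ∃ c : ℕ → F[X], IsDivisorChain n N c ∧
      (∀ j, j + 1 < n → f j ∣ c (j + 1) ∧ c j ∣ f (j + 1)) ∧
      ∀ j, j + r < n → c j ∣ g (j + r) ∧ g j ∣ c (j + r) := by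
  obtain ⟨m, rfl⟩ := Nat.exists_eq_succ_of_ne_zero hn
  obtain ⟨d, hd⟩ := Nat.exists_eq_add_of_le (sum_natDegree_shiftLcm_le hf hg hfg hgf)
  let c : ℕ → F[X] := fun i => shiftLcm r f g i * X ^ (if i = m then d else 0)
  have hLc (i : ℕ) : shiftLcm r f g i ∣ c i := dvd_mul_right _ _
  have hcL {i : ℕ} (hi : i < m) : c i = shiftLcm r f g i := by simp [c, hi.ne]
  refine ⟨c, ⟨?_, ?_, ?_⟩, fun j hj => ⟨?_, ?_⟩, fun j hj => ⟨?_, ?_⟩⟩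
  · exact fun i hi => mul_ne_zero (shiftLcm_ne_zero hf hg hi) (pow_ne_zero _ X_ne_zero)
  · intro i hi
    rw [hcL (by omega)]
    refine dvd_trans (shiftLcm_dvd (fun h => ?_) fun h => ?_) (hLc (i + 1))
    · exact (hf.dvd (by omega) (by omega)).trans (dvd_shiftLcm_succ r f g i)
    · rw [show i + 1 = (i - r + 1) + r by omega]
      exact (hg.dvd_succ _ (by omega)).trans (dvd_shiftLcm_add r f g _)
  · rw [hd, Finset.sum_range_succ, Finset.sum_range_succ, add_assoc]
    congr 1
    · exact Finset.sum_congr rfl fun i hi => by rw [hcL (Finset.mem_range.1 hi)]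
    · simp [c, natDegree_mul (shiftLcm_ne_zero (r := r) hf hg (Nat.lt_succ_self m))
        (pow_ne_zero d X_ne_zero)]
  · exact (dvd_shiftLcm_succ r f g j).trans (hLc _)
  · rw [hcL (by omega)]
    refine shiftLcm_dvd (fun h => hf.dvd (by omega) hj) fun h => ?_
    rw [show j + 1 = (j - r) + (r + 1) by omega]
    exact hgf _ (by omega)
  · rw [hcL (by omega)]
    refine shiftLcm_dvd (fun h => ?_) fun h => hg.dvd (by omega) hj
    rw [show j + r = (j - 1) + (r + 1) by omega]
    exact hfg _ (by omega)
  · exact (dvd_shiftLcm_add r f g j).trans (hLc _)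

lemma CyclicSum.rankClose_zero {f g : ℕ → F[X]} (hfg : ∀ i < n, f i ∣ g i)
    (hgf : ∀ i < n, g i ∣ f i) : RankClose 0 (CyclicSum.mulX n f) (CyclicSum.mulX n g) := by
  let S : CyclicSum n f ≃ₗ[F[X]] CyclicSum n g :=
    LinearEquiv.piCongrRight fun i : Fin n => Submodule.quotEquivOfEq _ _
      (le_antisymm (Ideal.span_singleton_le_span_singleton.2 (hgf i i.2))
        (Ideal.span_singleton_le_span_singleton.2 (hfg i i.2)))
  exact RankClose.of_comp_eq (S.restrictScalars F) fun x => S.map_smul X x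

/-- Divisor chains of the same degree that interlace with shift `r` give `r`-close
endomorphisms. -/
lemma CyclicSum.rankClose {r N : ℕ} (hn : n ≠ 0) {f g : ℕ → F[X]} (hf : IsDivisorChain n N f)
    (hg : IsDivisorChain n N g) (hfg : ∀ j, j + r < n → f j ∣ g (j + r))
    (hgf : ∀ j, j + r < n → g j ∣ f (j + r)) :
    RankClose r (CyclicSum.mulX n f) (CyclicSum.mulX n g) := by
  have hone {f g : ℕ → F[X]} (hf : IsDivisorChain n N f) (hg : IsDivisorChain n N g)
      (hfg : ∀ j, j + 1 < n → f j ∣ g (j + 1)) (hgf : ∀ j, j + 1 < n → g j ∣ f (j + 1)) :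
      RankClose 1 (CyclicSum.mulX n f) (CyclicSum.mulX n g) :=
    CyclicSum.rankClose_one hn hf.ne_zero hg.ne_zero hf.dvd_succ hg.dvd_succ hfg hgf
      (hf.sum_natDegree.trans hg.sum_natDegree.symm)
  rcases Nat.eq_zero_or_pos r with rfl | hr
  · exact CyclicSum.rankClose_zero hfg hgf
  induction r, hr using Nat.le_induction generalizing f g with
  | base => exact hone hf hg hfg hgf
  | succ r hr ih =>
    obtain ⟨c, hc, hfc, hcg⟩ := hf.exists_intermediate (by omega) hn hg hfg hgf
    rw [add_comm r 1]
    exact (hone hf hc (fun j hj => (hfc j hj).1) fun j hj => (hfc j hj).2).trans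
      (ih hc hg (fun j hj => (hcg j hj).1) fun j hj => (hcg j hj).2)

end DivisorChain

section PencilModule

open Polynomial Matrix

variable {F : Type*} [Field F] {n : ℕ}

lemma UnitEquiv.isDivisorChain {A : Matrix (Fin n) (Fin n) F} {f : ℕ → F[X]}
    (h : UnitEquiv (pencilOf A 1) (Matrix.diagonal fun i : Fin n => f i))
    (hf : ∀ i, i + 1 < n → f i ∣ f (i + 1)) : IsDivisorChain n n f := by
  obtain ⟨P, Q, hPQ⟩ := h
  have hP := (Matrix.isUnit_iff_isUnit_det _).1 P.isUnit
  have hQ := (Matrix.isUnit_iff_isUnit_det _).1 Q.isUnit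
  have hdet := congrArg Matrix.det hPQ
  rw [Matrix.det_mul, Matrix.det_mul, Matrix.det_diagonal, ← Finset.prod_range] at hdet
  have hA := det_pencilOf_one_ne_zero A
  have hne : ∏ i ∈ Finset.range n, f i ≠ 0 := by
    rw [← hdet]
    exact mul_ne_zero (mul_ne_zero hP.ne_zero hA) hQ.ne_zero
  have hne' := Finset.prod_ne_zero_iff.1 hne
  refine ⟨fun i hi => hne' i (Finset.mem_range.2 hi), hf, ?_⟩
  rw [← natDegree_prod _ _ hne', ← hdet, natDegree_mul (mul_ne_zero hP.ne_zero hA) hQ.ne_zero,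
    natDegree_mul hP.ne_zero hA, natDegree_eq_zero_of_isUnit hP, natDegree_eq_zero_of_isUnit hQ,
    pencilOf_one_eq_charmatrix]
  exact (zero_add _).trans ((Matrix.charpoly_natDegree_eq_dim (-A)).trans (Fintype.card_fin n))

lemma pencilOf_one_mulVec (A : Matrix (Fin n) (Fin n) F) (v : Fin n → F) :
    pencilOf A 1 *ᵥ (fun i => C (v i)) =
      (fun i => C ((A *ᵥ v) i)) + (X : F[X]) • fun i => C (v i) := by
  rw [pencilOf, Matrix.add_mulVec, Matrix.smul_mulVec, Matrix.map_one _ C_0 C_1, Matrix.one_mulVec]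
  congr 1
  exact funext fun i => (RingHom.map_mulVec C A v i).symm

/-- A monic pencil which is unit equivalent to a diagonal matrix presents the module
`⨁ F[X] / (f i)`. -/
lemma UnitEquiv.rankClose_zero {A : Matrix (Fin n) (Fin n) F} {f : ℕ → F[X]}
    (h : UnitEquiv (pencilOf A 1) (Matrix.diagonal fun i : Fin n => f i))
    (hf : IsDivisorChain n n f) : RankClose 0 (Matrix.toLin' (-A)) (CyclicSum.mulX n f) := by
  obtain ⟨P, Q, hPQ⟩ := h
  let π : (Fin n → F[X]) →ₗ[F[X]] CyclicSum n f :=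
    Fintype.linearCombination F[X] (CyclicSum.gen f)
  have hπ (w : Fin n → F[X]) : π w = ∑ i, w i • CyclicSum.gen f i := rfl
  let ρ : (Fin n → F[X]) →ₗ[F[X]] CyclicSum n f := π ∘ₗ P.val.mulVecLin
  have hρ (w : Fin n → F[X]) : ρ (pencilOf A 1 *ᵥ w) = 0 := by
    have hw : P.val *ᵥ pencilOf A 1 *ᵥ w =
        (Matrix.diagonal fun i : Fin n => f i) *ᵥ
          Q⁻¹.val *ᵥ w := by
      rw [← hPQ, Matrix.mulVec_mulVec, Matrix.mulVec_mulVec, Units.mul_inv_cancel_right]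
    change π (P.val *ᵥ pencilOf A 1 *ᵥ w) = 0
    rw [hw, hπ]
    refine Finset.sum_eq_zero fun i _ => ?_
    rw [Matrix.mulVec_diagonal, mul_comm, mul_smul, CyclicSum.smul_gen_self, smul_zero]
  let T : (Fin n → F) →ₗ[F] CyclicSum n f :=
    ρ.restrictScalars F ∘ₗ (Algebra.linearMap F F[X]).compLeft (Fin n)
  have hT (v : Fin n → F) : T v = ρ fun i => C (v i) := rfl
  have hXT (v : Fin n → F) : T (Matrix.toLin' (-A) v) = (X : F[X]) • T v := by
    have h1 := hρ fun i => C (v i)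
    rw [pencilOf_one_mulVec, map_add, map_smul, ← hT, ← hT, add_eq_zero_iff_neg_eq] at h1
    rw [← h1, Matrix.toLin'_apply, Matrix.neg_mulVec, map_neg]
  have hsmul (q : F[X]) (v : Fin n → F) : q • T v ∈ LinearMap.range T := by
    induction q using Polynomial.induction_on generalizing v with
    | C a => exact ⟨a • v, by rw [map_smul, ← algebraMap_smul F[X] a (T v)]; rfl⟩
    | add p q hp hq => rw [add_smul]; exact add_mem (hp v) (hq v)
    | monomial k a ih =>
      rw [pow_succ, ← mul_assoc, mul_smul, ← hXT]
      exact ih _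
  have hsurj : Function.Surjective T := by
    intro x
    obtain ⟨c, hc⟩ := CyclicSum.eq_sum_smul_gen f x
    let w := P⁻¹.val *ᵥ c
    have hx : x = ρ w := by
      change x = π (P.val *ᵥ w)
      rw [Matrix.mulVec_mulVec, Units.mul_inv, Matrix.one_mulVec, hc, hπ]
    have hw : w = ∑ i, w i • fun j => C ((Pi.single i 1 : Fin n → F) j) := by
      ext1 j
      simp [Finset.sum_apply, Pi.single_apply]
    rw [hx, hw, map_sum]
    exact sum_mem (S := LinearMap.range T) fun i _ => by
      rw [map_smul, ← hT]
      exact hsmul _ _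
  have := CyclicSum.finite hf.ne_zero
  have hfinrank : Module.finrank F (Fin n → F) = Module.finrank F (CyclicSum n f) := by
    rw [CyclicSum.finrank hf.ne_zero, hf.sum_natDegree, Module.finrank_fin_fun]
  have hbij : Function.Bijective T :=
    ⟨(LinearMap.injective_iff_surjective_of_finrank_eq_finrank hfinrank).2 hsurj, hsurj⟩
  exact RankClose.of_comp_eq (.ofBijective T hbij) hXT

lemma Interlace.dvd {R : Type*} [CommRing R] {r : ℕ} {φ ψ : ℕ → R} (h : Interlace n r φ ψ) (j : ℕ)
    (hj : j + r < n) : φ j ∣ ψ (j + r) ∧ ψ j ∣ φ (j + r) := by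
  have h1 := (h (j + r + 1) (by omega) (by omega)).1
  have h2 := (h (j + 1) (by omega) (by omega)).2
  simp only [extIF] at h1 h2
  rw [if_neg (by omega), if_neg (by omega), if_neg (by omega), if_neg (by omega)] at h1 h2
  constructor
  · convert h1 using 2 <;> omega
  · convert h2 using 2 <;> omega

/-- If `sI + A` and `sI + B` have interlacing invariant factors, then `B` is similar to a
perturbation of `A` of rank at most `r`. -/
lemma exists_rank_le_similar {r : ℕ} (hn : n ≠ 0) {A B : Matrix (Fin n) (Fin n) F}
    {f g : ℕ → F[X]} (hA : UnitEquiv (pencilOf A 1) (Matrix.diagonal fun i : Fin n => f i))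
    (hB : UnitEquiv (pencilOf B 1) (Matrix.diagonal fun i : Fin n => g i))
    (hf : ∀ i, i + 1 < n → f i ∣ f (i + 1)) (hg : ∀ i, i + 1 < n → g i ∣ g (i + 1))
    (hfg : ∀ j, j + r < n → f j ∣ g (j + r)) (hgf : ∀ j, j + r < n → g j ∣ f (j + r)) :
    ∃ D T : Matrix (Fin n) (Fin n) F, D.rank ≤ r ∧ IsUnit T.det ∧ T * (A + D) = B * T := by
  have hf' := hA.isDivisorChain hf
  have hg' := hB.isDivisorChain hg
  obtain ⟨S, hS⟩ := ((hA.rankClose_zero hf').trans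
    (CyclicSum.rankClose hn hf' hg' hfg hgf)).trans (hB.rankClose_zero hg').symm
  rw [zero_add, add_zero] at hS
  let T := LinearMap.toMatrix' S.toLinearMap
  let T' := LinearMap.toMatrix' S.symm.toLinearMap
  have hT : T * T' = 1 := by
    rw [← LinearMap.toMatrix'_comp]
    simp
  have hunit : IsUnit T.det := (Matrix.isUnit_iff_isUnit_det _).1 (.of_mul_eq_one _ hT)
  refine ⟨T' * (B * T - T * A), T, ?_, hunit, ?_⟩
  · refine (Matrix.rank_mul_le_right _ _).trans ?_
    have heq : S.toLinearMap ∘ₗ Matrix.toLin' (-A) - Matrix.toLin' (-B) ∘ₗ S.toLinearMap =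
        (B * T - T * A).mulVecLin := by
      rw [← Matrix.toLin'_apply', map_sub, Matrix.toLin'_mul, Matrix.toLin'_mul,
        Matrix.toLin'_toMatrix', map_neg, map_neg, LinearMap.comp_neg, LinearMap.neg_comp]
      abel
    rw [heq] at hS
    exact Module.finrank_le_of_rank_le hS
  · rw [mul_add, ← Matrix.mul_assoc, hT, Matrix.one_mul]
    abel

end PencilModule

section ExactRank

open Polynomial Matrix

lemma Matrix.rank_fromBlocks_one_zero {K ι κ : Type*} [Field K] [Fintype ι] [Fintype κ]
    [DecidableEq ι] [DecidableEq κ] :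
    (Matrix.fromBlocks 1 0 0 0 : Matrix (ι ⊕ κ) (ι ⊕ κ) K).rank = Fintype.card ι := by
  classical
  have h : (Matrix.fromBlocks 1 0 0 0 : Matrix (ι ⊕ κ) (ι ⊕ κ) K) =
      Matrix.diagonal (Sum.elim 1 0) := by
    rw [← Matrix.fromBlocks_diagonal]
    simp
  rw [h, Matrix.rank_diagonal]
  rw [Fintype.card_subtype, ← Finset.card_univ,
    ← Finset.card_map (Function.Embedding.inl (α := ι) (β := κ))]
  congr 1
  ext (i | k) <;> simp

lemma Matrix.rank_map_ringHom {K L ι : Type*} [Field K] [Field L] [Fintype ι] (f : K →+* L)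
    (M : Matrix ι ι K) : (M.map f).rank = M.rank := by
  classical
  obtain ⟨V, U, e, hV, hU, h⟩ := M.exists_rank_normal_form
  have hV' := (Matrix.isUnit_iff_isUnit_det _).1 (hV.map f.mapMatrix)
  have hU' := (Matrix.isUnit_iff_isUnit_det _).1 (hU.map f.mapMatrix)
  have h' := congrArg f.mapMatrix h
  rw [map_mul, map_mul] at h'
  have hrank := congrArg Matrix.rank h'
  rw [Matrix.rank_mul_eq_left_of_isUnit_det _ _ hU', Matrix.rank_mul_eq_right_of_isUnit_det _ _ hV',
    RingHom.mapMatrix_apply, RingHom.mapMatrix_apply, ← Matrix.submatrix_map, Matrix.fromBlocks_map,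
    Matrix.map_one _ f.map_zero f.map_one, Matrix.map_zero _ f.map_zero,
    Matrix.map_zero _ f.map_zero, Matrix.map_zero _ f.map_zero,
    Matrix.rank_submatrix, Matrix.rank_fromBlocks_one_zero, Fintype.card_fin] at hrank
  exact hrank

variable {F : Type*} [Field F] {n : ℕ}

lemma Matrix.isUnit_permMatrix (σ : Equiv.Perm (Fin n)) : IsUnit (σ.permMatrix F) := by
  rw [Matrix.isUnit_iff_isUnit_det, Matrix.det_permutation]
  exact (Equiv.Perm.sign σ).isUnit.map (Int.castRingHom F)

/-- Row reduction: the rows of index at least the rank can be cleared. -/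
lemma Matrix.exists_isUnit_mul_apply_eq_zero (D : Matrix (Fin n) (Fin n) F) :
    ∃ S : Matrix (Fin n) (Fin n) F, IsUnit S ∧ ∀ i j : Fin n, D.rank ≤ i → (S * D) i j = 0 := by
  obtain ⟨V, U, e, hV, hU, h⟩ := D.exists_rank_normal_form
  have hk : D.rank + (Fintype.card (Fin n) - D.rank) = n := by
    have := D.rank_le_card_width
    rw [Fintype.card_fin] at this ⊢
    omega
  let σ : Equiv.Perm (Fin n) := (finCongr hk.symm).trans (finSumFinEquiv.symm.trans e.symm)
  have hσ (i : Fin n) (hi : D.rank ≤ i) : ∃ k, e (σ i) = .inr k := by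
    have : finCongr hk.symm i = Fin.natAdd D.rank ⟨i - D.rank, by omega⟩ := by
      ext
      simp [hi]
    refine ⟨⟨i - D.rank, by omega⟩, ?_⟩
    change e (e.symm (finSumFinEquiv.symm (finCongr hk.symm i))) = _
    rw [this, Equiv.apply_symm_apply, finSumFinEquiv_symm_apply_natAdd]
  refine ⟨σ.permMatrix F * V, ?_, fun i j hi => ?_⟩
  · refine IsUnit.mul ?_ hV
    exact Matrix.isUnit_permMatrix σ
  · obtain ⟨U, rfl⟩ := hU
    have hVD : V * D = (Matrix.fromBlocks 1 0 0 0).submatrix e e * U⁻¹.val := by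
      rw [← h, Units.mul_inv_cancel_right]
    obtain ⟨k, hk⟩ := hσ i hi
    rw [Matrix.mul_assoc, Equiv.Perm.permMatrix, PEquiv.toMatrix_toPEquiv_mul, hVD,
      Matrix.submatrix_apply, Matrix.mul_apply]
    refine Finset.sum_eq_zero fun l _ => ?_
    rw [Matrix.submatrix_apply, hk]
    rcases e l <;> simp

lemma Matrix.exists_factor_of_rank_lt {D : Matrix (Fin n) (Fin n) F} {r : ℕ} (hD : D.rank ≤ r)
    (hr : r < n) :
    ∃ E G : Matrix (Fin n) (Fin n) F, E.rank = r ∧ IsUnit (1 + E) ∧ D = E * G := by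
  classical
  obtain ⟨m, rfl⟩ : ∃ m, n = m + 1 := ⟨n - 1, by omega⟩
  obtain ⟨S, hS, hSD⟩ := D.exists_isUnit_mul_apply_eq_zero
  obtain ⟨S, rfl⟩ := hS
  let J : Matrix (Fin (m + 1)) (Fin (m + 1)) F :=
    Matrix.diagonal fun i => if (i : ℕ) < r then 1 else 0
  let c := finRotate (m + 1)
  obtain ⟨C, hC⟩ := Matrix.isUnit_permMatrix (F := F) c
  have hJ : J.rank = r := by
    rw [Matrix.rank_diagonal, Fintype.card_subtype]
    simp [Fin.card_filter_val_lt, hr.le]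
  have hJD : J * (S.val * D) = S.val * D := by
    ext i j
    rw [Matrix.diagonal_mul]
    split_ifs with h
    · rw [one_mul]
    · rw [zero_mul, hSD i j (by omega)]
  have hJC : IsUnit (1 + J * C.val) := by
    have hJC_apply (i j) (h : j ≤ i) : (J * C.val) i j = 0 := by
      rw [hC, Matrix.diagonal_mul]
      split_ifs with hi
      · have hc : c i ≠ j := by
          refine ne_of_gt (h.trans_lt ?_)
          obtain ⟨i, hi'⟩ := i
          rw [finRotate_of_lt (show i < m by simp at hi; omega)]
          exact Fin.mk_lt_mk.2 i.lt_succ_self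
        rw [one_mul, Equiv.Perm.permMatrix, PEquiv.toMatrix_apply, if_neg]
        simpa [eq_comm] using hc
      · rw [zero_mul]
    rw [Matrix.isUnit_iff_isUnit_det, Matrix.det_of_isUpperTriangular]
    · simp [hJC_apply]
    · intro i j (hij : j < i)
      rw [Matrix.add_apply, hJC_apply i j hij.le, Matrix.one_apply_ne hij.ne', add_zero]
  refine ⟨S⁻¹.val * (J * C.val) * S.val, S⁻¹.val * C⁻¹.val * (S.val * D), ?_, ?_, ?_⟩
  · have hu (u : (Matrix (Fin (m + 1)) (Fin (m + 1)) F)ˣ) : IsUnit u.val.det :=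
      (Matrix.isUnit_iff_isUnit_det _).1 u.isUnit
    rw [Matrix.rank_mul_eq_left_of_isUnit_det _ _ (hu S),
      Matrix.rank_mul_eq_right_of_isUnit_det _ _ (hu _),
      Matrix.rank_mul_eq_left_of_isUnit_det _ _ (hu C), hJ]
  · have : 1 + S⁻¹.val * (J * C.val) * S.val = S⁻¹.val * (1 + J * C.val) * S.val := by
      rw [mul_add, add_mul, mul_one, Units.inv_mul]
    rw [this]
    exact (S⁻¹.isUnit.mul hJC).mul S.isUnit
  · calc D = S⁻¹.val * (J * (S.val * D)) := by rw [hJD, Units.inv_mul_cancel_left]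
      _ = S⁻¹.val * (J * (C.val * (S.val * (S⁻¹.val * (C⁻¹.val * (S.val * D)))))) := by
        rw [Units.mul_inv_cancel_left, Units.mul_inv_cancel_left]
      _ = _ := by simp only [mul_assoc]

/-- Over any field there is an `n × n` matrix, `n ≥ 2`, without the eigenvalues `0` and `-1`. -/
lemma Matrix.exists_isUnit_isUnit_one_add (hn : 2 ≤ n) :
    ∃ E : Matrix (Fin n) (Fin n) F, IsUnit E ∧ IsUnit (1 + E) := by
  let p : F[X] := X ^ n + (X ^ (n - 1) + 1)
  have hlt : (X ^ (n - 1) + 1 : F[X]).degree < n := by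
    refine (degree_add_le _ _).trans_lt (max_lt ?_ ?_)
    · rw [degree_X_pow]
      exact_mod_cast (by omega : n - 1 < n)
    · rw [degree_one]
      exact_mod_cast (by omega : 0 < n)
  have hp : p.Monic := monic_X_pow_add hlt
  have hdeg : p.natDegree = n := natDegree_eq_of_degree_eq_some (by
    rw [degree_add_eq_left_of_degree_lt (by rwa [degree_X_pow]), degree_X_pow])
  let pb := AdjoinRoot.powerBasis' hp
  let L := Algebra.leftMulMatrix (pb.basis.reindex (finCongr (show pb.dim = n from hdeg)))
  let x := AdjoinRoot.root p
  have hx : x ^ (n - 1) * (1 + x) = -1 := by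
    have h : AdjoinRoot.mk p p = 0 := AdjoinRoot.mk_self
    have hpow : x ^ n = x ^ (n - 1) * x := by rw [← pow_succ]; congr 1; omega
    simp only [p, map_add, map_pow, AdjoinRoot.mk_X, map_one] at h
    change x ^ n + (x ^ (n - 1) + 1) = 0 at h
    linear_combination h - hpow
  have hunit : IsUnit (x ^ (n - 1) * (1 + x)) := hx ▸ isUnit_one.neg
  refine ⟨L x, IsUnit.map L ((isUnit_pow_iff (by omega)).1 (isUnit_of_mul_isUnit_left hunit)), ?_⟩
  rw [← map_one L, ← map_add]
  exact (isUnit_of_mul_isUnit_right hunit).map L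

lemma Matrix.exists_factor_of_rank_le (hn : 2 ≤ n) {D : Matrix (Fin n) (Fin n) F} {r : ℕ}
    (hD : D.rank ≤ r) (hr : r ≤ n) :
    ∃ E G : Matrix (Fin n) (Fin n) F, E.rank = r ∧ IsUnit (1 + E) ∧ D = E * G := by
  rcases hr.lt_or_eq with h | rfl
  · exact Matrix.exists_factor_of_rank_lt hD h
  · obtain ⟨E, hE, hE'⟩ := Matrix.exists_isUnit_isUnit_one_add (F := F) hn
    obtain ⟨E, rfl⟩ := hE
    exact ⟨E, E⁻¹.val * D, by rw [Matrix.rank_of_isUnit _ E.isUnit, Fintype.card_fin], hE',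
      (Units.mul_inv_cancel_left _ _).symm⟩

lemma pencilOf_add_pencilOf (M N M' N' : Matrix (Fin n) (Fin n) F) :
    pencilOf M N + pencilOf M' N' = pencilOf (M + M') (N + N') := by
  simp only [pencilOf, Matrix.map_add _ fun _ _ => C_add, smul_add]
  abel

lemma map_C_mul_pencilOf (E M N : Matrix (Fin n) (Fin n) F) :
    E.map C * pencilOf M N = pencilOf (E * M) (E * N) := by
  simp only [pencilOf, Matrix.map_mul, mul_add, Matrix.mul_smul]

lemma pencilOf_mul_map_C (E M N : Matrix (Fin n) (Fin n) F) :
    pencilOf M N * E.map C = pencilOf (M * E) (N * E) := by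
  simp only [pencilOf, Matrix.map_mul, add_mul, Matrix.smul_mul]

lemma isPencil_pencilOf_s10 (M N : Matrix (Fin n) (Fin n) F) : IsPencil (pencilOf M N) := by
  intro i j
  rw [pencilOf, Matrix.add_apply, Matrix.smul_apply, smul_eq_mul, mul_comm, add_comm]
  exact degree_linear_le

/-- A rank `≤ r` perturbation of the constant term yields a pencil perturbation of normal rank
exactly `r`, up to strict equivalence. -/
lemma exists_normalRank_eq_strictEquiv (hn : 2 ≤ n) {A B D T : Matrix (Fin n) (Fin n) F} {r : ℕ}
    (hD : D.rank ≤ r) (hr : r ≤ n) (hT : IsUnit T.det) (h : T * (A + D) = B * T) :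
    ∃ P : Matrix (Fin n) (Fin n) F[X], IsPencil P ∧ normalRank P = r ∧
      StrictEquiv (pencilOf A 1 + P) (pencilOf B 1) := by
  obtain ⟨E, G, hE, hE', hDE⟩ := Matrix.exists_factor_of_rank_le hn hD hr
  obtain ⟨T, rfl⟩ := (Matrix.isUnit_iff_isUnit_det _).2 hT
  refine ⟨E.map C * pencilOf (A + D + G) 1, ?_, ?_,
    (1 + E) * T⁻¹.val, T, ?_, hT, ?_⟩
  · rw [map_C_mul_pencilOf]
    exact isPencil_pencilOf_s10 _ _
  · have hdet : IsUnit ((pencilOf (A + D + G) 1).map (algebraMap F[X] (RatFunc F))).det := by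
      rw [← RingHom.mapMatrix_apply, ← RingHom.map_det, isUnit_iff_ne_zero,
        map_ne_zero_iff _ (RatFunc.algebraMap_injective F)]
      exact det_pencilOf_one_ne_zero _
    rw [normalRank, Matrix.map_mul, Matrix.rank_mul_eq_left_of_isUnit_det _ _ hdet, Matrix.map_map,
      ← hE, ← Matrix.rank_map_ringHom ((algebraMap F[X] (RatFunc F)).comp C) E]
    rfl
  · exact (Matrix.isUnit_iff_isUnit_det _).1 (hE'.mul T⁻¹.isUnit)
  · have hsim : T⁻¹.val * B * T.val = A + D := by
      rw [mul_assoc, ← h, Units.inv_mul_cancel_left]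
    rw [map_C_mul_pencilOf, pencilOf_add_pencilOf, map_C_mul_pencilOf, pencilOf_mul_map_C]
    congr 1
    · rw [mul_assoc (1 + E), mul_assoc (1 + E), hsim, add_mul, one_mul, mul_add E (A + D), ← hDE]
      abel
    · rw [mul_one, mul_one, Units.inv_mul_cancel_right]

lemma dehomogenize_dvd {p q : MvPolynomial (Fin 2) F} (h : p ∣ q) :
    dehomogenize p ∣ dehomogenize q := by
  obtain ⟨c, rfl⟩ := h
  exact ⟨dehomogenize c, map_mul _ _ _⟩

end ExactRank

/-- For `n ≥ 2`, pencils `sI + A`, `sI + B` with homogeneous invariant factors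
`φ`, `ψ` and `0 ≤ r ≤ n`, if the interlacing conditions `φ_{i-r} ∣ ψ_i ∣ φ_{i+r}` hold, then
there is a pencil `P(s)` of normal rank exactly `r` with `A(s) + P(s)` strictly equivalent
to `B(s)`. -/
theorem stmt10 (F : Type*) [Field F] (n : ℕ) (hn : 2 ≤ n)
    (A B : Matrix (Fin n) (Fin n) F) (φ ψ : ℕ → MvPolynomial (Fin 2) F)
    (hφ : IsHomogeneousIF A 1 φ) (hφc : ∀ i, i + 1 < n → φ i ∣ φ (i + 1))
    (hψ : IsHomogeneousIF B 1 ψ) (hψc : ∀ i, i + 1 < n → ψ i ∣ ψ (i + 1))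
    (r : ℕ) (hr : r ≤ n) (hint : Interlace n r φ ψ) :
    ∃ P : Matrix (Fin n) (Fin n) (Polynomial F), IsPencil P ∧ normalRank P = r ∧
      StrictEquiv (pencilOf A 1 + P) (pencilOf B 1) := by
  obtain ⟨D, T, hD, hT, h⟩ := exists_rank_le_similar (by omega) hφ.unitEquiv_diagonal
    hψ.unitEquiv_diagonal (fun i hi => dehomogenize_dvd (hφc i hi))
    (fun i hi => dehomogenize_dvd (hψc i hi))
    (fun j hj => dehomogenize_dvd (hint.dvd j hj).1)
    (fun j hj => dehomogenize_dvd (hint.dvd j hj).2)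
  exact exists_normalRank_eq_strictEquiv hn hD hr hT h
end
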